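/- arXiv:1606.04776 — 4 statements merged into one kernel-verified Lean document; each statement's English description precedes it below -/
import Mathlib

section
/- Assume that the generalized Abel equation (1) satisfies Hypothesis (H). Then (1) has at most m isolated periodic solutions; precisely, the set of real numbers x_0 such that the solution of (1) with initial value x(0) = x_0 is a periodic solution and is isolated has at most m elements. -/
open Set

/-- `x` is a periodic solution of `dx/dt = S(x,t)` on `[0,1]`. -/
def IsPeriodicSol (S : ℝ → ℝ → ℝ) (x : ℝ → ℝ) : Prop :=
  (∀ t ∈ Set.Icc (0:ℝ) 1, HasDerivWithinAt x (S (x t) t) (Set.Icc (0:ℝ) 1) t) ∧ x 0 = x 1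

/-- An isolated periodic solution. -/
def IsIsolatedPeriodicSol (S : ℝ → ℝ → ℝ) (x : ℝ → ℝ) : Prop :=
  IsPeriodicSol S x ∧
    ∃ ε > 0, ∀ y : ℝ → ℝ, IsPeriodicSol S y → |y 0 - x 0| < ε → y 0 = x 0

/-- Hypothesis (H). -/
def HypH (m : ℕ) (S : ℝ → ℝ → ℝ) : Prop :=
  ∃ lam : ℕ → ℝ,
    (∀ i j, 1 ≤ i → i < j → j ≤ m → lam i < lam j) ∧
    ((∀ i, 1 ≤ i → i ≤ m → ∀ t ∈ Set.Icc (0:ℝ) 1, 0 ≤ (-1:ℝ) ^ i * S (lam i) t) ∨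
     (∀ i, 1 ≤ i → i ≤ m → ∀ t ∈ Set.Icc (0:ℝ) 1, (-1:ℝ) ^ i * S (lam i) t ≤ 0))

/-- A function on `[0,1]` with nonnegative derivative and equal end values has zero derivative. -/
theorem deriv_eq_zero_of_nonneg_of_closed {f f' : ℝ → ℝ}
    (hf : ∀ t ∈ Icc (0:ℝ) 1, HasDerivWithinAt f (f' t) (Icc 0 1) t)
    (hf' : ∀ t ∈ Icc (0:ℝ) 1, 0 ≤ f' t) (h01 : f 0 = f 1) :
    ∀ t ∈ Icc (0:ℝ) 1, f' t = 0 := by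
  have hmono : MonotoneOn f (Icc 0 1) := by
    refine monotoneOn_of_hasDerivWithinAt_nonneg (f' := f') (convex_Icc 0 1)
      (fun t ht => (hf t ht).continuousWithinAt)
      (fun t ht => (hf t (interior_subset ht)).mono interior_subset)
      (fun t ht => hf' t (interior_subset ht))
  have h0 : (0:ℝ) ∈ Icc (0:ℝ) 1 := by simp
  have h1 : (1:ℝ) ∈ Icc (0:ℝ) 1 := by simp
  have hconst : ∀ t ∈ Icc (0:ℝ) 1, f t = f 0 := fun t ht =>
    le_antisymm (h01 ▸ hmono ht h1 ht.2) (hmono h0 ht ht.1)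
  intro t ht
  have hz : HasDerivWithinAt f 0 (Icc 0 1) t :=
    (hasDerivWithinAt_const t (Icc (0:ℝ) 1) (f 0)).congr_of_mem hconst ht
  exact (uniqueDiffOn_Icc zero_lt_one t ht).eq_deriv _ (hf t ht) hz

/-- A periodic solution of a scalar linear equation with nonnegative forcing has constant sign. -/
theorem linear_periodic_trichotomy_of_nonneg {u q b : ℝ → ℝ}
    (hu : ∀ t ∈ Icc (0:ℝ) 1, HasDerivWithinAt u (q t * u t + b t) (Icc 0 1) t)
    (hq : ContinuousOn q (Icc 0 1)) (hb : ∀ t ∈ Icc (0:ℝ) 1, 0 ≤ b t) (h01 : u 0 = u 1) :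
    (∀ t ∈ Icc (0:ℝ) 1, 0 < u t) ∨ (∀ t ∈ Icc (0:ℝ) 1, u t = 0) ∨
      (∀ t ∈ Icc (0:ℝ) 1, u t < 0) := by
  set q' : ℝ → ℝ := IccExtend zero_le_one ((Icc (0:ℝ) 1).domRestrict q) with hq'
  have hq'c : Continuous q' := (continuousOn_iff_continuous_domRestrict.1 hq).Icc_extend'
  have hq'e : ∀ t ∈ Icc (0:ℝ) 1, q' t = q t := fun t ht => by
    rw [hq', IccExtend_of_mem _ _ ht]; rfl
  set Q : ℝ → ℝ := fun t => ∫ s in (0:ℝ)..t, q' s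
  have hQ : ∀ t, HasDerivAt Q (q' t) t := fun t => hq'c.integral_hasStrictDerivAt 0 t |>.hasDerivAt
  set v : ℝ → ℝ := fun t => u t * Real.exp (-Q t)
  have hv : ∀ t ∈ Icc (0:ℝ) 1,
      HasDerivWithinAt v (b t * Real.exp (-Q t)) (Icc 0 1) t := fun t ht => by
    refine ((hu t ht).mul ((hQ t).neg.exp.hasDerivWithinAt)).congr_deriv ?_
    rw [hq'e t ht, Pi.neg_apply]; ring
  have hmono : MonotoneOn v (Icc 0 1) := by
    refine monotoneOn_of_hasDerivWithinAt_nonneg (convex_Icc 0 1)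
      (fun t ht => (hv t ht).continuousWithinAt)
      (fun t ht => (hv t (interior_subset ht)).mono interior_subset)
      (fun t ht => mul_nonneg (hb t (interior_subset ht)) (Real.exp_pos _).le)
  have h0 : (0:ℝ) ∈ Icc (0:ℝ) 1 := by simp
  have h1 : (1:ℝ) ∈ Icc (0:ℝ) 1 := by simp
  rcases lt_trichotomy (u 0) 0 with h | h | h
  · refine .inr (.inr fun t ht => ?_)
    have h2 : v t ≤ v 1 := hmono ht h1 ht.2
    have h3 : v 1 < 0 := mul_neg_of_neg_of_pos (h01 ▸ h) (Real.exp_pos _)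
    exact neg_of_mul_neg_left (h2.trans_lt h3) (Real.exp_pos _).le
  · refine .inr (.inl fun t ht => ?_)
    have h2 : v t ≤ v 1 := hmono ht h1 ht.2
    have h3 : v 0 ≤ v t := hmono h0 ht ht.1
    have h4 : v 0 = 0 := by simp [v, h]
    have h5 : v 1 = 0 := by simp [v, ← h01, h]
    have h6 : v t = 0 := le_antisymm (h2.trans_eq h5) (h4 ▸ h3)
    exact (mul_eq_zero.1 h6).resolve_right (Real.exp_pos _).ne'
  · refine .inl fun t ht => ?_
    have h2 : v 0 ≤ v t := hmono h0 ht ht.1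
    have h3 : 0 < v 0 := mul_pos h (Real.exp_pos _)
    exact pos_of_mul_pos_left (h3.trans_le h2) (Real.exp_pos _).le

/-- A periodic solution of a scalar linear equation with forcing of one sign has constant sign. -/
theorem linear_periodic_trichotomy {u q b : ℝ → ℝ}
    (hu : ∀ t ∈ Icc (0:ℝ) 1, HasDerivWithinAt u (q t * u t + b t) (Icc 0 1) t)
    (hq : ContinuousOn q (Icc 0 1))
    (hb : (∀ t ∈ Icc (0:ℝ) 1, 0 ≤ b t) ∨ (∀ t ∈ Icc (0:ℝ) 1, b t ≤ 0)) (h01 : u 0 = u 1) :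
    (∀ t ∈ Icc (0:ℝ) 1, 0 < u t) ∨ (∀ t ∈ Icc (0:ℝ) 1, u t = 0) ∨
      (∀ t ∈ Icc (0:ℝ) 1, u t < 0) := by
  rcases hb with hb | hb
  · exact linear_periodic_trichotomy_of_nonneg hu hq hb h01
  · have := linear_periodic_trichotomy_of_nonneg (u := fun t => -u t) (q := q)
      (b := fun t => -b t) (fun t ht => (hu t ht).fun_neg.congr_deriv (by ring)) hq
      (fun t ht => neg_nonneg.2 (hb t ht)) (by simp [h01])
    simp only [Left.neg_pos_iff, neg_eq_zero, Left.neg_neg_iff] at this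
    tauto

/-- Comparison of a periodic solution of a polynomial equation with a curve `z` which is
an upper or a lower solution with `z 0 = z 1`. -/
theorem periodicSol_trichotomy {m : ℕ} {a : ℕ → ℝ → ℝ}
    (ha : ∀ i ≤ m, ContinuousOn (a i) (Icc 0 1)) {S : ℝ → ℝ → ℝ}
    (hS : ∀ x t, S x t = ∑ i ∈ Finset.range (m + 1), a i t * x ^ i)
    {x z z' : ℝ → ℝ} (hx : IsPeriodicSol S x)
    (hz : ∀ t ∈ Icc (0:ℝ) 1, HasDerivWithinAt z (z' t) (Icc 0 1) t) (hz01 : z 0 = z 1)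
    (hsign : (∀ t ∈ Icc (0:ℝ) 1, 0 ≤ S (z t) t - z' t) ∨
      (∀ t ∈ Icc (0:ℝ) 1, S (z t) t - z' t ≤ 0)) :
    (∀ t ∈ Icc (0:ℝ) 1, z t < x t) ∨ (∀ t ∈ Icc (0:ℝ) 1, x t = z t) ∨
      (∀ t ∈ Icc (0:ℝ) 1, x t < z t) := by
  have hxc : ContinuousOn x (Icc 0 1) := fun t ht => (hx.1 t ht).continuousWithinAt
  have hzc : ContinuousOn z (Icc 0 1) := fun t ht => (hz t ht).continuousWithinAt
  have key := linear_periodic_trichotomy (u := fun t => x t - z t)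
    (q := fun t => ∑ i ∈ Finset.range (m + 1),
      a i t * ∑ k ∈ Finset.range i, x t ^ k * z t ^ (i - 1 - k))
    (b := fun t => S (z t) t - z' t)
    (fun t ht => by
      refine ((hx.1 t ht).sub (hz t ht)).congr_deriv ?_
      rw [Finset.sum_mul]
      simp_rw [mul_assoc, geom_sum₂_mul, mul_sub, Finset.sum_sub_distrib, ← hS]
      ring)
    (by
      refine continuousOn_finsetSum _ fun i hi => ?_
      refine (ha i (by simpa [Nat.lt_succ_iff] using hi)).mul ?_
      exact continuousOn_finsetSum _ fun k _ => (hxc.pow _).mul (hzc.pow _))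
    hsign (by simp [hx.2, hz01])
  simpa only [sub_pos, sub_eq_zero, sub_neg] using key

/-- If the vector field separates as `f z t = c t / G' z` on an open interval containing the orbit,
then the periodic solution is not isolated. -/
theorem not_isolated_of_separable {f : ℝ → ℝ → ℝ} {x c G G' : ℝ → ℝ} {J : Set ℝ}
    (hJo : IsOpen J) (hJ : J.OrdConnected) (hG : ∀ z ∈ J, HasStrictDerivAt G (G' z) z)
    (hG0 : ∀ z ∈ J, G' z ≠ 0) (hxJ : ∀ t ∈ Icc (0:ℝ) 1, x t ∈ J)
    (hf : ∀ t ∈ Icc (0:ℝ) 1, ∀ z ∈ J, G' z * f z t = c t) :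
    ¬ IsIsolatedPeriodicSol f x := by
  rintro ⟨hx, ε, hε, hiso⟩
  have hcont : ContinuousOn G J := fun z hz => (hG z hz).hasDerivAt.continuousAt.continuousWithinAt
  have hlt : ∀ p ∈ J, ∀ q ∈ J, p < q → G p ≠ G q := by
    intro p hp q hq hpq he
    have hsub : Icc p q ⊆ J := hJ.out hp hq
    obtain ⟨r, hr, hr0⟩ := exists_hasDerivAt_eq_zero hpq (hcont.mono hsub) he
      fun z hz => (hG z (hsub (Ioo_subset_Icc_self hz))).hasDerivAt
    exact hG0 r (hsub (Ioo_subset_Icc_self hr)) hr0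
  have hinj : InjOn G J := by
    intro p hp q hq he
    rcases lt_trichotomy p q with h | h | h
    · exact (hlt p hp q hq h he).elim
    · exact h
    · exact (hlt q hq p hp h he.symm).elim
  have hopen : IsOpenMap (J.domRestrict G) := by
    refine isOpenMap_iff_nhds_le.2 fun z => ?_
    have hm : Filter.map (J.domRestrict G) (nhds z) = Filter.map G (nhds (z : ℝ)) := by
      rw [← hJo.isOpenEmbedding_subtypeVal.map_nhds_eq z, Filter.map_map]
      rfl
    rw [hm, (hG z z.2).map_nhds_eq (hG0 z z.2)]
    rfl
  let e : OpenPartialHomeomorph ℝ ℝ :=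
    OpenPartialHomeomorph.ofContinuousOpenRestrict hinj.toPartialEquiv hcont hopen hJo
  have hee : ∀ z, e z = G z := fun z => rfl
  have hxc : ContinuousOn x (Icc 0 1) := fun t ht => (hx.1 t ht).continuousWithinAt
  have hGx : ContinuousOn (fun t => G (x t)) (Icc 0 1) := hcont.comp hxc hxJ
  obtain ⟨δ, hδ, hδsub⟩ := (isCompact_Icc.image_of_continuousOn hGx).exists_thickening_subset_open
    e.open_target (by
      rintro _ ⟨t, ht, rfl⟩
      exact e.map_source (hxJ t ht))
  have h0 : (0:ℝ) ∈ Icc (0:ℝ) 1 := by simp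
  have hsymm : ContinuousAt e.symm (G (x 0)) := e.continuousAt_symm (e.map_source (hxJ 0 h0))
  obtain ⟨η, hη, hηsub⟩ := Metric.continuousAt_iff.1 hsymm ε hε
  set g : ℝ := min δ η / 2
  have hg : 0 < g := by positivity
  have hgδ : g < δ := (half_lt_self (by positivity)).trans_le (min_le_left _ _)
  have hgη : g < η := (half_lt_self (by positivity)).trans_le (min_le_right _ _)
  have htar : ∀ t ∈ Icc (0:ℝ) 1, G (x t) + g ∈ e.target := fun t ht => by
    refine hδsub (Metric.mem_thickening_iff.2 ⟨G (x t), mem_image_of_mem _ ht, ?_⟩)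
    simpa [Real.dist_eq, abs_of_pos hg] using hgδ
  have hy : IsPeriodicSol f (fun t => e.symm (G (x t) + g)) := by
    refine ⟨fun t ht => ?_, by simp [hx.2]⟩
    have hyJ : e.symm (G (x t) + g) ∈ J := e.map_target (htar t ht)
    have hd := e.hasDerivAt_symm (htar t ht) (hG0 _ hyJ) (hG _ hyJ).hasDerivAt
    have hd2 : HasDerivWithinAt (fun t => G (x t) + g) (G' (x t) * f (x t) t) (Icc 0 1) t :=
      ((hG _ (hxJ t ht)).hasDerivAt.comp_hasDerivWithinAt t (hx.1 t ht)).add_const g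
    refine (hd.comp_hasDerivWithinAt t hd2).congr_deriv ?_
    rw [hf t ht _ (hxJ t ht), ← hf t ht _ hyJ, inv_mul_cancel_left₀ (hG0 _ hyJ)]
  have hleft : e.symm (G (x 0)) = x 0 := e.left_inv (hxJ 0 h0)
  have hclose := hηsub (x := G (x 0) + g) (by simpa [Real.dist_eq, abs_of_pos hg] using hgη)
  rw [hleft, Real.dist_eq] at hclose
  have heq := hiso _ hy hclose
  have hr : e (e.symm (G (x 0) + g)) = G (x 0) + g := e.right_inv (htar 0 h0)
  rw [heq, hee] at hr
  linarith

open Lagrange in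
/-- The nodal weights of an increasing sequence of nodes alternate in sign. -/
theorem nodalWeight_sign {m : ℕ} {lam : ℕ → ℝ}
    (hlam : ∀ i j, 1 ≤ i → i < j → j ≤ m → lam i < lam j) {i : ℕ} (hi : i ∈ Finset.Icc 1 m) :
    0 < (-1:ℝ) ^ m * ((-1) ^ i * nodalWeight (Finset.Icc 1 m) lam i) := by
  rw [Finset.mem_Icc] at hi
  have hsplit : (Finset.Icc 1 m).erase i = Finset.Ico 1 i ∪ Finset.Ioc i m := by
    ext j; simp only [Finset.mem_erase, Finset.mem_Icc, Finset.mem_union, Finset.mem_Ico,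
      Finset.mem_Ioc]; omega
  have hdisj : Disjoint (Finset.Ico 1 i) (Finset.Ioc i m) := by
    rw [Finset.disjoint_left]; intro j; simp only [Finset.mem_Ico, Finset.mem_Ioc]; omega
  have hpow : (-1:ℝ) ^ m * (-1) ^ i = ∏ _j ∈ Finset.Ioc i m, (-1:ℝ) := by
    obtain ⟨k, rfl⟩ := Nat.exists_eq_add_of_le hi.2
    rw [Finset.prod_const, Nat.card_Ioc, Nat.add_sub_cancel_left, pow_add, mul_right_comm,
      ← pow_add, Even.neg_one_pow ⟨i, rfl⟩, one_mul]
  rw [nodalWeight, hsplit, Finset.prod_union hdisj, ← mul_assoc, hpow, mul_left_comm,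
    ← Finset.prod_mul_distrib]
  refine mul_pos (Finset.prod_pos fun j hj => ?_) (Finset.prod_pos fun j hj => ?_)
  · rw [Finset.mem_Ico] at hj
    exact inv_pos.2 (sub_pos.2 (hlam j i hj.1 hj.2 hi.2))
  · rw [Finset.mem_Ioc] at hj
    have := inv_lt_zero.2 (sub_neg.2 (hlam i j hi.1 hj.1 hj.2))
    linarith

open Lagrange Polynomial in
/-- Partial fraction expansion, with respect to `m` nodes, of a polynomial of degree at most `m`. -/
theorem polynomial_eq_nodal_mul_partialFraction {ι : Type*} [DecidableEq ι] {s : Finset ι}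
    {v : ι → ℝ} (hv : InjOn v s) (c : ℕ → ℝ) {x : ℝ} (hx : ∀ i ∈ s, x ≠ v i) :
    ∑ k ∈ Finset.range (s.card + 1), c k * x ^ k =
      (nodal s v).eval x * (c s.card + ∑ i ∈ s, nodalWeight s v i * (x - v i)⁻¹ *
        ∑ k ∈ Finset.range (s.card + 1), c k * v i ^ k) := by
  set p : ℝ[X] := ∑ k ∈ Finset.range s.card, C (c k) * X ^ k -
    C (c s.card) * (nodal s v - X ^ s.card) with hp
  have hpe : ∀ z, p.eval z = ∑ k ∈ Finset.range (s.card + 1), c k * z ^ k -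
      c s.card * (nodal s v).eval z := fun z => by
    simp only [hp, eval_sub, eval_finsetSum, eval_mul, eval_C, eval_pow, eval_X,
      Finset.sum_range_succ]
    ring
  have hdeg1 : (nodal s v - X ^ s.card).degree < (s.card : WithBot ℕ) := by
    have := degree_sub_lt_left (p := nodal s v) (q := X ^ s.card) (by simp [degree_nodal])
      nodal_ne_zero (by rw [(nodal_monic).leadingCoeff, (monic_X_pow _).leadingCoeff])
    rwa [degree_nodal] at this
  have hdeg : p.degree < (s.card : WithBot ℕ) := by
    refine (degree_sub_le _ _).trans_lt (max_lt ?_ ?_)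
    · refine (degree_sum_le _ _).trans_lt ((Finset.sup_lt_iff (WithBot.bot_lt_coe _)).2 ?_)
      intro k hk
      exact (degree_C_mul_X_pow_le _ _).trans_lt (by exact_mod_cast Finset.mem_range.1 hk)
    · rw [← smul_eq_C_mul]
      exact (degree_smul_le _ _).trans_lt hdeg1
  have hint := eq_interpolate_of_eval_eq (f := p)
    (fun i => ∑ k ∈ Finset.range (s.card + 1), c k * v i ^ k) hv hdeg
    (fun i hi => by rw [hpe, eval_nodal_at_node hi]; ring)
  have := eval_interpolate_not_at_node
    (fun i => ∑ k ∈ Finset.range (s.card + 1), c k * v i ^ k) hx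
  rw [← hint, hpe] at this
  rw [mul_add, ← this]
  ring

/-- Strict derivative of a weighted sum of logarithms, away from the nodes. -/
theorem hasStrictDerivAt_sum_mul_log {ι : Type*} {s : Finset ι} {v w : ι → ℝ} {z : ℝ}
    (hz : ∀ i ∈ s, z ≠ v i) :
    HasStrictDerivAt (fun z => ∑ i ∈ s, w i * Real.log (z - v i))
      (∑ i ∈ s, w i * (z - v i)⁻¹) z := by
  refine HasStrictDerivAt.fun_sum fun i hi => HasStrictDerivAt.const_mul _ ?_
  have h := (Real.hasStrictDerivAt_log (sub_ne_zero.2 (hz i hi))).comp z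
    ((hasStrictDerivAt_id z).sub_const (v i))
  rw [mul_one] at h
  exact h

/-- Two ordered periodic solutions lying in the same arc of the complement of the active nodes
force all residues to vanish. -/
theorem residues_eq_zero_of_two_periodicSol {ι : Type*} {s : Finset ι} {v w : ι → ℝ}
    {r : ι → ℝ → ℝ} {c : ℝ → ℝ} {f : ℝ → ℝ → ℝ} {x y : ℝ → ℝ} {σ ε : ℝ}
    (hx : IsPeriodicSol f x) (hy : IsPeriodicSol f y)
    (hf : ∀ t ∈ Icc (0:ℝ) 1, ∀ z, (∀ i ∈ s, z ≠ v i) →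
      (∑ i ∈ s, w i * (z - v i)⁻¹) * f z t = c t + ∑ i ∈ s, w i * (z - v i)⁻¹ * r i t)
    (hxv : ∀ t ∈ Icc (0:ℝ) 1, ∀ i ∈ s, x t ≠ v i) (hyv : ∀ t ∈ Icc (0:ℝ) 1, ∀ i ∈ s, y t ≠ v i)
    (hσ : ∀ i ∈ s, ∀ t ∈ Icc (0:ℝ) 1, 0 ≤ σ * (w i * r i t))
    (hxy : ∀ t ∈ Icc (0:ℝ) 1, x t < y t)
    (hε : ∀ i ∈ s, (∀ t ∈ Icc (0:ℝ) 1, r i t = 0) ∨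
      ∀ t ∈ Icc (0:ℝ) 1, 0 < ε * ((x t - v i) * (y t - v i))) :
    ∀ i ∈ s, ∀ t ∈ Icc (0:ℝ) 1, σ * (w i * r i t) = 0 := by
  set G : ℝ → ℝ := fun z => ∑ i ∈ s, w i * Real.log (z - v i)
  have hG : ∀ {z : ℝ → ℝ}, IsPeriodicSol f z → (∀ t ∈ Icc (0:ℝ) 1, ∀ i ∈ s, z t ≠ v i) →
      ∀ t ∈ Icc (0:ℝ) 1, HasDerivWithinAt (fun t => G (z t))
        (c t + ∑ i ∈ s, w i * (z t - v i)⁻¹ * r i t) (Icc 0 1) t := by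
    intro z hz hzv t ht
    rw [← hf t ht _ (hzv t ht)]
    exact (hasStrictDerivAt_sum_mul_log (hzv t ht)).hasDerivAt.comp_hasDerivWithinAt t (hz.1 t ht)
  have hterm : ∀ i ∈ s, ∀ t ∈ Icc (0:ℝ) 1,
      0 ≤ σ * (w i * r i t) * (ε * ((x t - v i)⁻¹ - (y t - v i)⁻¹)) ∧
      (σ * (w i * r i t) * (ε * ((x t - v i)⁻¹ - (y t - v i)⁻¹)) = 0 →
        σ * (w i * r i t) = 0) := by
    intro i hi t ht
    rcases hε i hi with h | h
    · simp [h t ht]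
    · have hx0 := sub_ne_zero.2 (hxv t ht i hi)
      have hy0 := sub_ne_zero.2 (hyv t ht i hi)
      have hpos : 0 < ε * ((x t - v i)⁻¹ - (y t - v i)⁻¹) := by
        have he : ε * ((x t - v i)⁻¹ - (y t - v i)⁻¹) =
            ε * ((x t - v i) * (y t - v i)) * (y t - x t) / ((x t - v i) * (y t - v i)) ^ 2 := by
          field_simp
          ring
        rw [he]
        exact div_pos (mul_pos (h t ht) (sub_pos.2 (hxy t ht)))
          (sq_pos_of_ne_zero (mul_ne_zero hx0 hy0))
      exact ⟨mul_nonneg (hσ i hi t ht) hpos.le, fun h0 => (mul_eq_zero.1 h0).resolve_right hpos.ne'⟩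
  have hsum := deriv_eq_zero_of_nonneg_of_closed
    (f := fun t => σ * ε * (G (x t) - G (y t)))
    (f' := fun t => ∑ i ∈ s, σ * (w i * r i t) * (ε * ((x t - v i)⁻¹ - (y t - v i)⁻¹)))
    (fun t ht => by
      refine (((hG hx hxv t ht).sub (hG hy hyv t ht)).const_mul (σ * ε)).congr_deriv ?_
      rw [add_sub_add_left_eq_sub, ← Finset.sum_sub_distrib, Finset.mul_sum]
      exact Finset.sum_congr rfl fun i _ => by ring)
    (fun t ht => Finset.sum_nonneg fun i hi => (hterm i hi t ht).1)
    (by simp only [hx.2, hy.2])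
  intro i hi t ht
  exact (hterm i hi t ht).2
    ((Finset.sum_eq_zero_iff_of_nonneg fun i hi => (hterm i hi t ht).1).1 (hsum t ht) i hi)

/-- The real numbers having the same position as `p` with respect to finitely many nodes form an
open interval. -/
theorem isOpen_ordConnected_setOf_same_side {ι : Type*} (s : Finset ι) (v : ι → ℝ) (p : ℝ) :
    IsOpen {z : ℝ | ∀ i ∈ s, 0 < (z - v i) * (p - v i)} ∧
      {z : ℝ | ∀ i ∈ s, 0 < (z - v i) * (p - v i)}.OrdConnected := by
  constructor
  · simp only [ofPred_forall]
    exact isOpen_biInter_finset fun i _ => isOpen_lt continuous_const (by fun_prop)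
  · refine ⟨fun a ha b hb z hz i hi => ?_⟩
    have h1 := ha i hi
    have h2 := hb i hi
    rcases le_total 0 (p - v i) with h | h
    · exact h1.trans_le (mul_le_mul_of_nonneg_right (by linarith [hz.1]) h)
    · exact h2.trans_le (mul_le_mul_of_nonpos_right (by linarith [hz.2]) h)

/-- If two numbers have, modulo `A.card`, the same number of nodes on their left, then no node
separates them or all nodes do. -/
theorem same_side_or_opposite_of_card_mod_eq {ι : Type*} {A : Finset ι} {v : ι → ℝ} {p q : ℝ}
    (hpq : p < q) (hp : ∀ i ∈ A, p ≠ v i) (hq : ∀ i ∈ A, q ≠ v i)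
    (h : (A.filter fun i => v i < p).card % A.card = (A.filter fun i => v i < q).card % A.card) :
    ∃ ε : ℝ, ∀ i ∈ A, 0 < ε * ((p - v i) * (q - v i)) := by
  have hsub : (A.filter fun i => v i < p) ⊆ A.filter fun i => v i < q := fun i hi => by
    rw [Finset.mem_filter] at hi ⊢
    exact ⟨hi.1, hi.2.trans hpq⟩
  have hle := Finset.card_le_card hsub
  have hqA := Finset.card_le_card (Finset.filter_subset (fun i => v i < q) A)
  by_cases hc : (A.filter fun i => v i < p).card = (A.filter fun i => v i < q).card
  · refine ⟨1, fun i hi => ?_⟩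
    have heq := Finset.eq_of_subset_of_card_le hsub hc.ge
    have hiff : v i < p ↔ v i < q := by
      have := Finset.ext_iff.1 heq i
      simpa [hi] using this
    rw [one_mul]
    by_cases h1 : v i < p
    · exact mul_pos (sub_pos.2 h1) (sub_pos.2 (hiff.1 h1))
    · exact mul_pos_of_neg_of_neg (sub_neg.2 ((hp i hi).lt_of_le (not_lt.1 h1)))
        (sub_neg.2 ((hq i hi).lt_of_le (not_lt.1 fun h2 => h1 (hiff.2 h2))))
  · have hlt : (A.filter fun i => v i < p).card < A.card := by omega
    have hqc : (A.filter fun i => v i < q).card = A.card := by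
      by_contra hne
      rw [Nat.mod_eq_of_lt hlt, Nat.mod_eq_of_lt (lt_of_le_of_ne hqA hne)] at h
      exact hc h
    rw [Nat.mod_eq_of_lt hlt, hqc, Nat.mod_self, Finset.card_eq_zero,
      Finset.filter_eq_empty_iff] at h
    have hall := Finset.filter_card_eq hqc
    refine ⟨-1, fun i hi => ?_⟩
    have h1 : p - v i < 0 := sub_neg.2 ((hp i hi).lt_of_le (not_lt.1 (h hi)))
    have h2 : 0 < q - v i := sub_pos.2 (hall i hi)
    linarith [mul_neg_of_neg_of_pos h1 h2]

/-- Theorem 1.1: under Hypothesis (H), the generalized Abel equation has at most `m`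
isolated periodic solutions. -/
theorem abel_H_at_most_m_isolated (m : ℕ) (hm : 1 ≤ m) (a : ℕ → ℝ → ℝ)
    (ha : ∀ i ≤ m, ContDiffOn ℝ (⊤ : ℕ∞) (a i) (Set.Icc (0:ℝ) 1))
    (S : ℝ → ℝ → ℝ)
    (hS : ∀ x t, S x t = ∑ i ∈ Finset.range (m + 1), a i t * x ^ i)
    (hH : HypH m S) :
    ∃ F : Finset ℝ, F.card ≤ m ∧
      {x0 : ℝ | ∃ x : ℝ → ℝ, IsIsolatedPeriodicSol S x ∧ x 0 = x0} ⊆ (F : Set ℝ) := by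
  classical
  obtain ⟨lam, hlam, hH⟩ := hH
  set s := Finset.Icc 1 m with hs
  have hcard : s.card = m := by simp [hs]
  have hne : s.Nonempty := ⟨1, by simp [hs, hm]⟩
  have h0 : (0:ℝ) ∈ Icc (0:ℝ) 1 := by simp
  have hlaminj : InjOn lam s := by
    intro i hi j hj hij
    simp only [hs, Finset.coe_Icc, mem_Icc] at hi hj
    rcases lt_trichotomy i j with h | h | h
    · exact absurd hij (hlam i j hi.1 h hj.2).ne
    · exact h
    · exact absurd hij (hlam j i hj.1 h hi.2).ne'
  set w : ℕ → ℝ := Lagrange.nodalWeight s lam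
  have hac : ∀ i ≤ m, ContinuousOn (a i) (Icc 0 1) := fun i hi => (ha i hi).continuousOn
  have hnode : ∀ i ∈ s, (∀ t ∈ Icc (0:ℝ) 1, 0 ≤ S (lam i) t) ∨
      (∀ t ∈ Icc (0:ℝ) 1, S (lam i) t ≤ 0) := by
    intro i hi
    rw [hs, Finset.mem_Icc] at hi
    rcases neg_one_pow_eq_or ℝ i with hp | hp <;> rcases hH with h | h <;>
      have h' := h i hi.1 hi.2 <;> rw [hp] at h'
    · exact .inl fun t ht => by linarith [h' t ht]
    · exact .inr fun t ht => by linarith [h' t ht]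
    · exact .inr fun t ht => by linarith [h' t ht]
    · exact .inl fun t ht => by linarith [h' t ht]
  obtain ⟨σ, hσ0, hσ⟩ : ∃ σ : ℝ, σ ≠ 0 ∧
      ∀ i ∈ s, ∀ t ∈ Icc (0:ℝ) 1, 0 ≤ σ * (w i * S (lam i) t) := by
    have hsq : ∀ i, ((-1:ℝ) ^ i) * (-1) ^ i = 1 := fun i => by
      rw [← pow_add, Even.neg_one_pow ⟨i, rfl⟩]
    have hfac : ∀ i t, (-1:ℝ) ^ m * (w i * S (lam i) t) =
        ((-1) ^ m * ((-1) ^ i * w i)) * ((-1) ^ i * S (lam i) t) := fun i t => by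
      linear_combination (-(-1:ℝ) ^ m * (w i * S (lam i) t)) * hsq i
    have hm0 : (-1:ℝ) ^ m ≠ 0 := pow_ne_zero _ (by norm_num)
    rcases hH with h | h
    · refine ⟨(-1) ^ m, hm0, fun i hi t ht => ?_⟩
      have hi' := Finset.mem_Icc.1 hi
      rw [hfac]
      exact mul_nonneg (nodalWeight_sign hlam hi).le (h i hi'.1 hi'.2 t ht)
    · refine ⟨-(-1) ^ m, neg_ne_zero.2 hm0, fun i hi t ht => ?_⟩
      have hi' := Finset.mem_Icc.1 hi
      rw [neg_mul, hfac, neg_nonneg]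
      exact mul_nonpos_of_nonneg_of_nonpos (nodalWeight_sign hlam hi).le (h i hi'.1 hi'.2 t ht)
  have htri : ∀ x, IsPeriodicSol S x → ∀ i ∈ s, (∀ t ∈ Icc (0:ℝ) 1, lam i < x t) ∨
      (∀ t ∈ Icc (0:ℝ) 1, x t = lam i) ∨ (∀ t ∈ Icc (0:ℝ) 1, x t < lam i) := fun x hx i hi =>
    periodicSol_trichotomy hac hS hx (z := fun _ => lam i) (z' := fun _ => 0)
      (fun t _ => hasDerivWithinAt_const _ _ _) rfl (by simpa using hnode i hi)
  have hside : ∀ x, IsPeriodicSol S x → ∀ i ∈ s, x 0 ≠ lam i → ∀ t ∈ Icc (0:ℝ) 1,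
      0 < (x t - lam i) * (x 0 - lam i) := by
    intro x hx i hi hxi t ht
    rcases htri x hx i hi with h | h | h
    · exact mul_pos (sub_pos.2 (h t ht)) (sub_pos.2 (h 0 h0))
    · exact absurd (h 0 h0) hxi
    · exact mul_pos_of_neg_of_neg (sub_neg.2 (h t ht)) (sub_neg.2 (h 0 h0))
  have hnz : ∀ x, IsPeriodicSol S x → (∀ i ∈ s, x 0 ≠ lam i) →
      ∀ t ∈ Icc (0:ℝ) 1, ∀ i ∈ s, x t ≠ lam i := fun x hx hxv t ht i hi he => by
    simpa [he] using hside x hx i hi (hxv i hi) t ht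
  have hnodal : ∀ z, (∀ i ∈ s, z ≠ lam i) →
      (∑ i ∈ s, w i * (z - lam i)⁻¹) * (Lagrange.nodal s lam).eval z = 1 := fun z hz => by
    have := Lagrange.eval_interpolate_not_at_node 1 hz
    rw [Lagrange.interpolate_one hlaminj hne, Polynomial.eval_one] at this
    rw [this, mul_comm]
    simp [w]
  have hf : ∀ t ∈ Icc (0:ℝ) 1, ∀ z, (∀ i ∈ s, z ≠ lam i) →
      (∑ i ∈ s, w i * (z - lam i)⁻¹) * S z t =
        a m t + ∑ i ∈ s, w i * (z - lam i)⁻¹ * S (lam i) t := by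
    intro t _ z hz
    have := polynomial_eq_nodal_mul_partialFraction hlaminj (fun k => a k t) hz
    simp only [hcard, ← hS] at this
    rw [this, ← mul_assoc, hnodal z hz, one_mul]
  set A := s.filter fun i => ∃ t ∈ Icc (0:ℝ) 1, S (lam i) t ≠ 0 with hA
  have hAs : A ⊆ s := Finset.filter_subset _ _
  have hinactive : ∀ i ∈ s, i ∉ A → ∀ t ∈ Icc (0:ℝ) 1, S (lam i) t = 0 := by
    intro i hi hiA t ht
    by_contra hc
    exact hiA (Finset.mem_filter.2 ⟨hi, t, ht, hc⟩)
  have hnodeA : ∀ x, IsPeriodicSol S x → ∀ i ∈ s, x 0 = lam i → i ∉ A := by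
    intro x hx i hi hxi hiA
    obtain ⟨-, t, ht, hSt⟩ := Finset.mem_filter.1 hiA
    have hconst : ∀ t ∈ Icc (0:ℝ) 1, x t = lam i := by
      rcases htri x hx i hi with h | h | h
      · exact absurd hxi (h 0 h0).ne'
      · exact h
      · exact absurd hxi (h 0 h0).ne
    have hd := hx.1 t ht
    rw [hconst t ht] at hd
    exact hSt ((uniqueDiffOn_Icc zero_lt_one t ht).eq_deriv _ hd
      ((hasDerivWithinAt_const t (Icc (0:ℝ) 1) (lam i)).congr_of_mem hconst ht))
  rcases A.eq_empty_or_nonempty with hAe | hAne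
  · refine ⟨s.image lam, Finset.card_image_le.trans hcard.le, ?_⟩
    rintro x0 ⟨x, hx, rfl⟩
    by_contra hxs
    have hxv : ∀ i ∈ s, x 0 ≠ lam i := fun i hi he =>
      hxs (Finset.mem_coe.2 (Finset.mem_image.2 ⟨i, hi, he.symm⟩))
    obtain ⟨hJo, hJ⟩ := isOpen_ordConnected_setOf_same_side s lam (x 0)
    have hJv : ∀ z ∈ {z : ℝ | ∀ i ∈ s, 0 < (z - lam i) * (x 0 - lam i)}, ∀ i ∈ s, z ≠ lam i :=
      fun z hz i hi he => by simpa [he] using hz i hi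
    refine not_isolated_of_separable hJo hJ (c := a m)
      (fun z hz => hasStrictDerivAt_sum_mul_log (w := w) (hJv z hz))
      (fun z hz => left_ne_zero_of_mul_eq_one (hnodal z (hJv z hz)))
      (fun t ht i hi => hside x hx.1 i hi (hxv i hi) t ht) (fun t ht z hz => ?_) hx
    rw [hf t ht z (hJv z hz), Finset.sum_eq_zero, add_zero]
    intro i hi
    rw [hinactive i hi (by simp [hAe]) t ht, mul_zero]
  · set N : Set ℝ := {x0 | ∃ x, IsPeriodicSol S x ∧ x 0 = x0 ∧ ∀ i ∈ s, x0 ≠ lam i} with hN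
    set k : ℝ → ℕ := fun p => (A.filter fun i => lam i < p).card % A.card
    have hkmaps : ∀ p ∈ N, k p ∈ (Finset.range A.card : Set ℕ) := fun p _ => by
      simpa using Nat.mod_lt _ hAne.card_pos
    have hlt : ∀ p ∈ N, ∀ q ∈ N, p < q → k p ≠ k q := by
      rintro _ ⟨x, hx, rfl, hxv⟩ _ ⟨y, hy, rfl, hyv⟩ hpq hk
      obtain ⟨ε, hε⟩ := same_side_or_opposite_of_card_mod_eq hpq (fun i hi => hxv i (hAs hi))
        (fun i hi => hyv i (hAs hi)) hk
      have hxy : ∀ t ∈ Icc (0:ℝ) 1, x t < y t := by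
        rcases periodicSol_trichotomy hac hS hx hy.1 hy.2 (by simp) with h | h | h
        · exact absurd (h 0 h0) hpq.not_gt
        · exact absurd (h 0 h0) hpq.ne
        · exact h
      have hres := residues_eq_zero_of_two_periodicSol hx hy hf (hnz x hx hxv) (hnz y hy hyv) hσ
        hxy (ε := ε) (fun i hi => by
          by_cases hiA : i ∈ A
          · refine .inr fun t ht => ?_
            have h1 := hside x hx i hi (hxv i hi) t ht
            have h2 := hside y hy i hi (hyv i hi) t ht
            have h3 := hε i hiA
            refine pos_of_mul_pos_left (b := ((x 0 - lam i) * (y 0 - lam i)) ^ 2) ?_ (sq_nonneg _)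
            calc 0 < (x t - lam i) * (x 0 - lam i) * ((y t - lam i) * (y 0 - lam i)) *
                  (ε * ((x 0 - lam i) * (y 0 - lam i))) := by positivity
              _ = _ := by ring
          · exact .inl (hinactive i hi hiA))
      obtain ⟨i, hiA⟩ := hAne
      obtain ⟨hi, t, ht, hSt⟩ := Finset.mem_filter.1 hiA
      have hw0 : w i ≠ 0 := Lagrange.nodalWeight_ne_zero hlaminj hi
      exact mul_ne_zero hσ0 (mul_ne_zero hw0 hSt) (hres i hi t ht)
    have hkinj : InjOn k N := by
      intro p hp q hq he
      rcases lt_trichotomy p q with h | h | h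
      · exact absurd he (hlt p hp q hq h)
      · exact h
      · exact absurd he.symm (hlt q hq p hp h)
    have hNfin : N.Finite := Set.Finite.of_injOn hkmaps hkinj (Finset.finite_toSet _)
    have hNcard : hNfin.toFinset.card ≤ A.card := by
      have := Set.ncard_le_ncard_of_injOn k hkmaps hkinj (Finset.finite_toSet _)
      rwa [Set.ncard_coe_finset, Finset.card_range, Set.ncard_eq_toFinset_card N hNfin] at this
    refine ⟨(s \ A).image lam ∪ hNfin.toFinset, ?_, ?_⟩
    · have h1 := Finset.card_union_le ((s \ A).image lam) hNfin.toFinset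
      have h2 : ((s \ A).image lam).card ≤ (s \ A).card := Finset.card_image_le
      have h3 := Finset.card_sdiff_add_card_eq_card hAs
      omega
    · rintro x0 ⟨x, hx, rfl⟩
      simp only [Finset.coe_union, Finset.coe_image, Set.Finite.coe_toFinset]
      by_cases hxv : ∀ i ∈ s, x 0 ≠ lam i
      · exact .inr ⟨x, hx.1, rfl, hxv⟩
      · push Not at hxv
        obtain ⟨i, hi, he⟩ := hxv
        exact .inl ⟨i, by simp [hi, hnodeA x hx.1 i hi he], he.symm⟩
end

section
/- Let \lambda_1 < \cdots < \lambda_m be real numbers and f(x) = \prod_{i=1}^m (x - \lambda_i). The autonomous equation dx/dt = f(x) satisfies Hypothesis (H), and its periodic solutions are exactly the m constant solutions x(t) \equiv \lambda_1, \ldots, x(t) \equiv \lambda_m; each of these is an isolated periodic solution. In particular, the upper bound m in Theorem 1 is attained, i.e., it is sharp. -/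
open Set

/-- A periodic solution of an autonomous scalar equation with continuous right-hand side `f` takes
values in the zero set of `f`: along it, an antiderivative of `f` is monotone and periodic. -/
theorem IsPeriodicSol.autonomous_zero {f : ℝ → ℝ} (hf : Continuous f) {x : ℝ → ℝ}
    (hx : IsPeriodicSol (fun u _ => f u) x) {t : ℝ} (ht : t ∈ Set.Icc (0:ℝ) 1) :
    f (x t) = 0 := by
  obtain ⟨hd, hp⟩ := hx
  let G : ℝ → ℝ := fun s => ∫ v in (0:ℝ)..(x s), f v
  have hG : ∀ s ∈ Set.Icc (0:ℝ) 1, HasDerivWithinAt G (f (x s) * f (x s)) (Set.Icc 0 1) s :=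
    fun s hs => ((hf.integral_hasStrictDerivAt 0 (x s)).hasDerivAt).comp_hasDerivWithinAt s (hd s hs)
  have hmono : MonotoneOn G (Set.Icc 0 1) :=
    monotoneOn_of_hasDerivWithinAt_nonneg (convex_Icc 0 1)
      (fun s hs => (hG s hs).continuousWithinAt)
      (fun s hs => (hG s (interior_subset hs)).mono interior_subset)
      (fun s _ => mul_self_nonneg _)
  have hends : G 0 = G 1 := congrArg (fun u => ∫ v in (0:ℝ)..u, f v) hp
  have hconst : ∀ s ∈ Set.Icc (0:ℝ) 1, G s = G 0 := fun s hs =>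
    le_antisymm
      (hends ▸ hmono hs (right_mem_Icc.2 zero_le_one) hs.2)
      (hmono (left_mem_Icc.2 zero_le_one) hs hs.1)
  have hzero : HasDerivWithinAt G 0 (Set.Icc 0 1) t :=
    (hasDerivWithinAt_const t _ (G 0)).congr hconst (hconst t ht)
  exact mul_self_eq_zero.1
    ((uniqueDiffOn_Icc zero_lt_one t ht).eq_deriv _ (hG t ht) hzero)

/-- A periodic solution of an autonomous scalar equation with continuous right-hand side is
constant. -/
theorem IsPeriodicSol.autonomous_eq {f : ℝ → ℝ} (hf : Continuous f) {x : ℝ → ℝ}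
    (hx : IsPeriodicSol (fun u _ => f u) x) {t : ℝ} (ht : t ∈ Set.Icc (0:ℝ) 1) :
    x t = x 0 := by
  have hd : ∀ s ∈ Set.Icc (0:ℝ) 1, HasDerivWithinAt x 0 (Set.Icc 0 1) s := fun s hs => by
    simpa only [hx.autonomous_zero hf hs] using hx.1 s hs
  have h := (convex_Icc (0:ℝ) 1).norm_image_sub_le_of_norm_hasDerivWithin_le (C := 0) hd
    (by simp) (left_mem_Icc.2 zero_le_one) ht
  rw [zero_mul] at h
  exact sub_eq_zero.1 (norm_le_zero_iff.1 h)

/-- Sharpness of Theorem 1.1: for `f(x) = ∏ (x - λᵢ)`, the autonomous equation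
`dx/dt = f(x)` satisfies (H), its periodic solutions are exactly the constants
`λ₁, …, λ_m`, and each of them is isolated. -/
theorem abel_sharpness (m : ℕ) (hm : 1 ≤ m) (lam : ℕ → ℝ)
    (hlt : ∀ i j, 1 ≤ i → i < j → j ≤ m → lam i < lam j)
    (f : ℝ → ℝ) (hf : ∀ x, f x = ∏ i ∈ Finset.Icc 1 m, (x - lam i))
    (S : ℝ → ℝ → ℝ) (hS : ∀ x t, S x t = f x) :
    HypH m S ∧
    (∀ x : ℝ → ℝ, IsPeriodicSol S x ↔
      ∃ i, 1 ≤ i ∧ i ≤ m ∧ ∀ t ∈ Set.Icc (0:ℝ) 1, x t = lam i) ∧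
    (∀ i, 1 ≤ i → i ≤ m → IsIsolatedPeriodicSol S (fun _ => lam i)) := by
  obtain rfl : S = fun u _ => f u := funext fun u => funext fun t => hS u t
  have hcont : Continuous f := by
    rw [funext hf]
    fun_prop
  have hroot : ∀ u, f u = 0 ↔ ∃ i, 1 ≤ i ∧ i ≤ m ∧ u = lam i := fun u => by
    simp [hf, Finset.prod_eq_zero_iff, sub_eq_zero, and_assoc]
  have hzero : ∀ i, 1 ≤ i → i ≤ m → f (lam i) = 0 := fun i h1 h2 => (hroot _).2 ⟨i, h1, h2, rfl⟩
  have hper : ∀ x : ℝ → ℝ, IsPeriodicSol (fun u _ => f u) x ↔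
      ∃ i, 1 ≤ i ∧ i ≤ m ∧ ∀ t ∈ Set.Icc (0:ℝ) 1, x t = lam i := by
    refine fun x => ⟨fun hx => ?_, ?_⟩
    · obtain ⟨i, h1, h2, hi⟩ :=
        (hroot (x 0)).1 (hx.autonomous_zero hcont (left_mem_Icc.2 zero_le_one))
      exact ⟨i, h1, h2, fun t ht => (hx.autonomous_eq hcont ht).trans hi⟩
    · rintro ⟨i, h1, h2, hi⟩
      refine ⟨fun t ht => ?_, ?_⟩
      · simp only [hi t ht, hzero i h1 h2]
        exact (hasDerivWithinAt_const t _ (lam i)).congr hi (hi t ht)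
      · rw [hi 0 (left_mem_Icc.2 zero_le_one), hi 1 (right_mem_Icc.2 zero_le_one)]
  refine ⟨⟨lam, hlt, Or.inl fun i h1 h2 t _ => by simp [hzero i h1 h2]⟩, hper,
    fun i h1 h2 => ⟨(hper _).2 ⟨i, h1, h2, fun _ _ => rfl⟩, ?_⟩⟩
  have hfin : (lam '' Set.Icc 1 m \ {lam i}).Finite := ((Set.finite_Icc 1 m).image lam).sdiff
  obtain ⟨ε, hε, hball⟩ := Metric.isOpen_iff.1 hfin.isClosed.isOpen_compl (lam i) (by simp)
  refine ⟨ε, hε, fun y hy hlt_eps => ?_⟩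
  obtain ⟨j, hj1, hj2, hj⟩ := (hper y).1 hy
  by_contra hne
  exact hball (Metric.mem_ball.2 hlt_eps)
    ⟨⟨j, ⟨hj1, hj2⟩, (hj 0 (left_mem_Icc.2 zero_le_one)).symm⟩, hne⟩
end

section
/- Assume Hypothesis (H') holds for equation (1): there exist real numbers \lambda_1 < \cdots < \lambda_m such that either (-1)^i \cdot D_{\lambda_i}(t) \ge 0 for all t \in [0,1] and all i = 1,\ldots,m, or (-1)^i \cdot D_{\lambda_i}(t) \le 0 for all t \in [0,1] and all i = 1,\ldots,m. Then equation (1) has at most m isolated periodic solutions; precisely, the set of real numbers x_0 such that the solution of (1) with initial value x(0) = x_0 is a periodic solution and is isolated has at most m elements. -/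
open Set

section ScalarCalculus

/-- A function on `[0,1]` with nonnegative derivative and equal end values is stationary. -/
theorem hasDerivWithinAt_eq_zero_of_nonneg_of_eq {f f' : ℝ → ℝ}
    (hf : ∀ t ∈ Icc (0:ℝ) 1, HasDerivWithinAt f (f' t) (Icc (0:ℝ) 1) t)
    (hnn : ∀ t ∈ Icc (0:ℝ) 1, 0 ≤ f' t) (h01 : f 0 = f 1) :
    ∀ t ∈ Icc (0:ℝ) 1, f' t = 0 := by
  have hmono : MonotoneOn f (Icc (0:ℝ) 1) :=
    monotoneOn_of_hasDerivWithinAt_nonneg (convex_Icc 0 1)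
      (fun t ht => (hf t ht).continuousWithinAt)
      (fun t ht => (hf t (interior_subset ht)).mono interior_subset)
      (fun t ht => hnn t (interior_subset ht))
  have hconst : ∀ t ∈ Icc (0:ℝ) 1, f t = f 0 := fun t ht =>
    le_antisymm (h01 ▸ hmono ht (right_mem_Icc.2 zero_le_one) ht.2)
      (hmono (left_mem_Icc.2 zero_le_one) ht ht.1)
  intro t ht
  have h0 : HasDerivWithinAt f 0 (Icc (0:ℝ) 1) t :=
    (hasDerivWithinAt_const t _ (f 0)).congr hconst (hconst t ht)
  exact (uniqueDiffOn_Icc_zero_one t ht).eq_deriv _ (hf t ht) h0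

theorem mul_pos_of_continuousOn_of_ne_zero {f : ℝ → ℝ} (hf : ContinuousOn f (Icc (0:ℝ) 1))
    (h0 : ∀ t ∈ Icc (0:ℝ) 1, f t ≠ 0) : ∀ t ∈ Icc (0:ℝ) 1, 0 < f 0 * f t := by
  intro t ht
  by_contra! hle
  have h0m : (0:ℝ) ∈ Icc (0:ℝ) 1 := left_mem_Icc.2 zero_le_one
  have hmem : (0:ℝ) ∈ f '' Icc (0:ℝ) 1 := by
    rcases mul_nonpos_iff.1 hle with h | h
    · exact isPreconnected_Icc.intermediate_value ht h0m hf ⟨h.2, h.1⟩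
    · exact isPreconnected_Icc.intermediate_value h0m ht hf ⟨h.1, h.2⟩
  obtain ⟨s, hs, hs0⟩ := hmem
  exact h0 s hs hs0

/-- A periodic solution of `e' = p + h e` with `p ≥ 0` vanishes nowhere or everywhere. -/
theorem linear_ne_zero_or_eq_zero_of_nonneg {e p h : ℝ → ℝ}
    (he : ∀ t ∈ Icc (0:ℝ) 1, HasDerivWithinAt e (p t + h t * e t) (Icc (0:ℝ) 1) t)
    (hh : ContinuousOn h (Icc (0:ℝ) 1)) (hp : ∀ t ∈ Icc (0:ℝ) 1, 0 ≤ p t)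
    (h01 : e 0 = e 1) :
    (∀ t ∈ Icc (0:ℝ) 1, e t ≠ 0) ∨ (∀ t ∈ Icc (0:ℝ) 1, e t = 0) := by
  have hk : Continuous (fun t => h (projIcc (0:ℝ) 1 zero_le_one t)) :=
    hh.comp_continuous (continuous_subtype_val.comp continuous_projIcc)
      (fun t => (projIcc (0:ℝ) 1 zero_le_one t).2)
  set H : ℝ → ℝ := fun t => ∫ s in (0:ℝ)..t, h (projIcc (0:ℝ) 1 zero_le_one s) with hH
  have hHd : ∀ t ∈ Icc (0:ℝ) 1, HasDerivWithinAt H (h t) (Icc (0:ℝ) 1) t := by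
    intro t ht
    have := (hk.integral_hasStrictDerivAt 0 t).hasDerivAt.hasDerivWithinAt (s := Icc (0:ℝ) 1)
    rwa [projIcc_of_mem zero_le_one ht] at this
  have hE : ∀ t ∈ Icc (0:ℝ) 1, HasDerivWithinAt (fun t => e t * Real.exp (-H t))
      (p t * Real.exp (-H t)) (Icc (0:ℝ) 1) t := by
    intro t ht
    exact ((he t ht).fun_mul (hHd t ht).fun_neg.exp).congr_deriv (by ring)
  have hmono : MonotoneOn (fun t => e t * Real.exp (-H t)) (Icc (0:ℝ) 1) :=
    monotoneOn_of_hasDerivWithinAt_nonneg (convex_Icc 0 1)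
      (fun t ht => (hE t ht).continuousWithinAt)
      (fun t ht => (hE t (interior_subset ht)).mono interior_subset)
      (fun t ht => mul_nonneg (hp t (interior_subset ht)) (Real.exp_pos _).le)
  by_cases hz : ∃ t ∈ Icc (0:ℝ) 1, e t = 0
  · right
    obtain ⟨t, ht, het⟩ := hz
    have h0m : (0:ℝ) ∈ Icc (0:ℝ) 1 := left_mem_Icc.2 zero_le_one
    have h1m : (1:ℝ) ∈ Icc (0:ℝ) 1 := right_mem_Icc.2 zero_le_one
    have hle0 : e 0 ≤ 0 := by
      have := hmono h0m ht ht.1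
      simp only [het, zero_mul] at this
      exact nonpos_of_mul_nonpos_left this (Real.exp_pos _)
    have hge1 : 0 ≤ e 1 := by
      have := hmono ht h1m ht.2
      simp only [het, zero_mul] at this
      exact nonneg_of_mul_nonneg_left this (Real.exp_pos _)
    have he0 : e 0 = 0 := le_antisymm hle0 (h01 ▸ hge1)
    have he1 : e 1 = 0 := h01 ▸ he0
    intro s hs
    have h1 := hmono h0m hs hs.1
    have h2 := hmono hs h1m hs.2
    simp only [he0, he1, zero_mul] at h1 h2
    exact (mul_eq_zero.1 (le_antisymm h2 h1)).resolve_right (Real.exp_pos _).ne'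
  · left
    push Not at hz
    exact hz

theorem linear_ne_zero_or_eq_zero {e p h : ℝ → ℝ}
    (he : ∀ t ∈ Icc (0:ℝ) 1, HasDerivWithinAt e (p t + h t * e t) (Icc (0:ℝ) 1) t)
    (hh : ContinuousOn h (Icc (0:ℝ) 1))
    (hp : (∀ t ∈ Icc (0:ℝ) 1, 0 ≤ p t) ∨ (∀ t ∈ Icc (0:ℝ) 1, p t ≤ 0))
    (h01 : e 0 = e 1) :
    (∀ t ∈ Icc (0:ℝ) 1, e t ≠ 0) ∨ (∀ t ∈ Icc (0:ℝ) 1, e t = 0) := by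
  rcases hp with hp | hp
  · exact linear_ne_zero_or_eq_zero_of_nonneg he hh hp h01
  · have := linear_ne_zero_or_eq_zero_of_nonneg (e := fun t => -e t) (p := fun t => -p t) (h := h)
      (fun t ht => (he t ht).fun_neg.congr_deriv (by ring)) hh
      (fun t ht => by linarith [hp t ht]) (by simp [h01])
    simpa using this

/-- The inverse of an injective function on an open set is differentiable wherever the derivative
does not vanish. -/
theorem hasDerivAt_invFunOn {F : ℝ → ℝ} {O : Set ℝ} {z F' : ℝ} (hO : IsOpen O)
    (hinj : InjOn F O) (hz : z ∈ O) (hF : HasStrictDerivAt F F' z) (hF' : F' ≠ 0) :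
    HasDerivAt (Function.invFunOn F O) F'⁻¹ (F z) := by
  have hleft : ∀ y ∈ O, Function.invFunOn F O (F y) = y := hinj.leftInvOn_invFunOn
  refine HasDerivAt.of_local_left_inverse (f := F) ?_ ?_ hF' ?_
  · rw [ContinuousAt, hleft z hz, ← hF.map_nhds_eq hF', Filter.tendsto_map'_iff]
    refine Filter.tendsto_id.congr' ?_
    filter_upwards [hO.mem_nhds hz] with y hy
    exact (hleft y hy).symm
  · rw [hleft z hz]
    exact hF.hasDerivAt
  · rw [← hF.map_nhds_eq hF', Filter.eventually_map]
    filter_upwards [hO.mem_nhds hz] with y hy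
    rw [hleft y hy]

end ScalarCalculus

section PartialFractions

open Polynomial Lagrange

theorem eval_mul_inv_nodal_eq {N : Finset ℝ} {p : ℝ[X]} (hp : p.natDegree ≤ N.card)
    {y : ℝ} (hy : y ∉ N) :
    p.eval y * ((nodal N id).eval y)⁻¹ =
      p.coeff N.card + ∑ k ∈ N, nodalWeight N id k * (y - k)⁻¹ * p.eval k := by
  have hQ : (nodal N (id : ℝ → ℝ)).eval y ≠ 0 := by
    rw [eval_nodal, Finset.prod_ne_zero_iff]
    intro k hk h
    exact hy (by rwa [sub_eq_zero.1 h])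
  set c := p.coeff N.card
  have hdeg : (p - C c * nodal N (id : ℝ → ℝ)).degree < N.card := by
    rw [degree_lt_iff_coeff_zero]
    intro j hj
    rw [coeff_sub, coeff_C_mul]
    rcases hj.eq_or_lt with rfl | hlt
    · have h1 : (nodal N (id : ℝ → ℝ)).coeff N.card = 1 := by
        have := (nodal_monic (s := N) (v := (id : ℝ → ℝ))).coeff_natDegree
        rwa [natDegree_nodal] at this
      rw [h1]; simp [c]
    · rw [coeff_eq_zero_of_natDegree_lt (hp.trans_lt hlt),
        coeff_eq_zero_of_natDegree_lt (by rwa [natDegree_nodal])]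
      simp
  have hint := eq_interpolate_of_eval_eq (fun k => p.eval k) (injOn_id (N : Set ℝ)) hdeg
    (fun k hk => by
      have : (nodal N (id : ℝ → ℝ)).eval (id k) = 0 := eval_nodal_at_node hk
      simp only [id] at this
      simp [this])
  have hev := congrArg (eval y) hint
  rw [eval_interpolate_not_at_node _ (fun k hk h => hy (by rw [h]; exact hk))] at hev
  simp only [eval_sub, eval_mul, eval_C, id] at hev
  have : p.eval y = (nodal N (id : ℝ → ℝ)).eval y *
      (c + ∑ k ∈ N, nodalWeight N id k * (y - k)⁻¹ * p.eval k) := by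
    rw [mul_add]
    linarith
  rw [this]
  field_simp

/-- A primitive of `1 / ∏ k ∈ N, (y - k)`. -/
noncomputable def logPotential (N : Finset ℝ) (y : ℝ) : ℝ :=
  ∑ k ∈ N, nodalWeight N id k * Real.log (y - k)

theorem hasStrictDerivAt_logPotential {N : Finset ℝ} (hN : N.Nonempty) {y : ℝ} (hy : y ∉ N) :
    HasStrictDerivAt (logPotential N) ((nodal N id).eval y)⁻¹ y := by
  have h1 := eval_mul_inv_nodal_eq (N := N) (p := 1) (by simp) hy
  have h0 : (1 : ℝ[X]).coeff N.card = 0 := by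
    rw [coeff_one, if_neg hN.card_pos.ne']
  simp only [eval_one, one_mul, h0, zero_add, mul_one] at h1
  rw [h1]
  refine HasStrictDerivAt.fun_sum fun k hk => ?_
  have hne : y - k ≠ 0 := fun h => hy (by rwa [sub_eq_zero.1 h])
  have hs : HasStrictDerivAt (fun x => x - k) 1 y := (hasStrictDerivAt_id y).sub_const k
  have := (hs.log hne).const_mul (nodalWeight N id k)
  rwa [one_div] at this

end PartialFractions

section AlternatingField

open Lagrange

/-- A time-dependent field, polynomial of degree at most `N.card` in the space variable, whose
values at consecutive nodes of `N` have alternating constant signs. -/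
structure AlternatingField (R : ℝ → ℝ → ℝ) (N : Finset ℝ) (σ : ℝ) : Prop where
  nonempty : N.Nonempty
  divided_difference : ∀ x y : ℝ → ℝ, ContinuousOn x (Icc (0:ℝ) 1) → ContinuousOn y (Icc (0:ℝ) 1) →
    ∃ h : ℝ → ℝ, ContinuousOn h (Icc (0:ℝ) 1) ∧
      ∀ t ∈ Icc (0:ℝ) 1, R (x t) t - R (y t) t = h t * (x t - y t)
  polynomial : ∀ t ∈ Icc (0:ℝ) 1, ∃ p : Polynomial ℝ, p.natDegree ≤ N.card ∧
    ∀ y, R y t = p.eval y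
  sign_ne_zero : σ ≠ 0
  sign : ∀ k ∈ N, ∀ t ∈ Icc (0:ℝ) 1, 0 ≤ σ * (nodalWeight N id k * R k t)

variable {R : ℝ → ℝ → ℝ} {N : Finset ℝ} {σ : ℝ}

theorem IsPeriodicSol.continuousOn {u : ℝ → ℝ} (hu : IsPeriodicSol R u) :
    ContinuousOn u (Icc (0:ℝ) 1) := fun t ht => (hu.1 t ht).continuousWithinAt

theorem AlternatingField.sub_ne_zero_or_eq_zero (hR : AlternatingField R N σ) {u₁ u₂ : ℝ → ℝ}
    (h₁ : IsPeriodicSol R u₁) (h₂ : IsPeriodicSol R u₂) :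
    (∀ t ∈ Icc (0:ℝ) 1, u₁ t - u₂ t ≠ 0) ∨ (∀ t ∈ Icc (0:ℝ) 1, u₁ t - u₂ t = 0) := by
  obtain ⟨h, hc, hh⟩ := hR.divided_difference u₁ u₂ h₁.continuousOn h₂.continuousOn
  refine linear_ne_zero_or_eq_zero (p := fun _ => 0) (h := h) (fun t ht => ?_) hc
    (Or.inl fun _ _ => le_rfl) (by rw [h₁.2, h₂.2])
  exact ((h₁.1 t ht).fun_sub (h₂.1 t ht)).congr_deriv (by rw [hh t ht, zero_add])

theorem AlternatingField.sub_node_ne_zero_or_eq_zero (hR : AlternatingField R N σ) {u : ℝ → ℝ}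
    (hu : IsPeriodicSol R u) {k : ℝ} (hk : k ∈ N) :
    (∀ t ∈ Icc (0:ℝ) 1, u t - k ≠ 0) ∨ (∀ t ∈ Icc (0:ℝ) 1, u t - k = 0) := by
  obtain ⟨h, hc, hh⟩ := hR.divided_difference u (fun _ => k) hu.continuousOn continuousOn_const
  have hw : σ * nodalWeight N id k ≠ 0 :=
    mul_ne_zero hR.sign_ne_zero (nodalWeight_ne_zero (injOn_id _) hk)
  refine linear_ne_zero_or_eq_zero (p := fun t => R k t) (h := h) (fun t ht => ?_) hc ?_
    (by rw [hu.2])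
  · exact ((hu.1 t ht).sub_const k).congr_deriv (by rw [← hh t ht]; ring)
  · rcases lt_or_gt_of_ne hw with hw | hw
    · refine Or.inr fun t ht => ?_
      have := hR.sign k hk t ht
      rw [← mul_assoc] at this
      exact nonpos_of_mul_nonneg_right this hw
    · refine Or.inl fun t ht => ?_
      have := hR.sign k hk t ht
      rw [← mul_assoc] at this
      exact nonneg_of_mul_nonneg_right this hw

/-- A periodic solution starting at a node is constant, and the field vanishes along it. -/
theorem AlternatingField.field_eq_zero_of_start_mem (hR : AlternatingField R N σ) {u : ℝ → ℝ}
    (hu : IsPeriodicSol R u) (h0 : u 0 ∈ N) : ∀ t ∈ Icc (0:ℝ) 1, R (u 0) t = 0 := by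
  rcases hR.sub_node_ne_zero_or_eq_zero hu h0 with h | h
  · exact absurd (sub_self _) (h 0 (left_mem_Icc.2 zero_le_one))
  · intro t ht
    have hconst : ∀ s ∈ Icc (0:ℝ) 1, u s = u 0 := fun s hs => sub_eq_zero.1 (h s hs)
    have hd : HasDerivWithinAt u 0 (Icc (0:ℝ) 1) t :=
      (hasDerivWithinAt_const t _ (u 0)).congr hconst (hconst t ht)
    have := (uniqueDiffOn_Icc_zero_one t ht).eq_deriv _ (hu.1 t ht) hd
    rwa [hconst t ht] at this

theorem AlternatingField.sub_node_ne_zero (hR : AlternatingField R N σ) {u : ℝ → ℝ}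
    (hu : IsPeriodicSol R u) (h0 : u 0 ∉ N) {k : ℝ} (hk : k ∈ N) :
    ∀ t ∈ Icc (0:ℝ) 1, u t - k ≠ 0 := by
  rcases hR.sub_node_ne_zero_or_eq_zero hu hk with h | h
  · exact h
  · have := sub_eq_zero.1 (h 0 (left_mem_Icc.2 zero_le_one))
    exact absurd (this ▸ hk) h0

theorem AlternatingField.notMem_nodes (hR : AlternatingField R N σ) {u : ℝ → ℝ}
    (hu : IsPeriodicSol R u) (h0 : u 0 ∉ N) : ∀ t ∈ Icc (0:ℝ) 1, u t ∉ N :=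
  fun t ht hmem => hR.sub_node_ne_zero hu h0 hmem t ht (sub_self _)

/-- Along a periodic solution avoiding the nodes, the potential moves at the speed given by the
partial fraction expansion of the field. -/
theorem AlternatingField.exists_hasDerivWithinAt_logPotential (hR : AlternatingField R N σ)
    {t : ℝ} (ht : t ∈ Icc (0:ℝ) 1) : ∃ c : ℝ,
      (∀ y ∉ N, R y t * ((nodal N id).eval y)⁻¹ =
        c + ∑ k ∈ N, nodalWeight N id k * (y - k)⁻¹ * R k t) ∧
      ∀ u : ℝ → ℝ, IsPeriodicSol R u → u 0 ∉ N →
        HasDerivWithinAt (fun s => logPotential N (u s))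
          (c + ∑ k ∈ N, nodalWeight N id k * (u t - k)⁻¹ * R k t) (Icc (0:ℝ) 1) t := by
  obtain ⟨p, hp, hpe⟩ := hR.polynomial t ht
  have hfrac : ∀ y ∉ N, R y t * ((nodal N id).eval y)⁻¹ =
      p.coeff N.card + ∑ k ∈ N, nodalWeight N id k * (y - k)⁻¹ * R k t := by
    intro y hy
    simp only [hpe]
    exact eval_mul_inv_nodal_eq hp hy
  refine ⟨p.coeff N.card, hfrac, fun u hu h0 => ?_⟩
  have hut := hR.notMem_nodes hu h0 t ht
  rw [← hfrac _ hut, mul_comm]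
  exact (hasStrictDerivAt_logPotential hR.nonempty hut).hasDerivAt.comp_hasDerivWithinAt t
    (hu.1 t ht)

/-- Two distinct periodic solutions lying on the same arc of the projective line minus the nodes
of `J` force the field to vanish at every node of `J`. -/
theorem AlternatingField.field_eq_zero_of_same_arc (hR : AlternatingField R N σ) {J : Finset ℝ}
    (hJN : J ⊆ N) (hJ : ∀ k ∈ N, k ∉ J → ∀ t ∈ Icc (0:ℝ) 1, R k t = 0)
    {u₁ u₂ : ℝ → ℝ} (h₁ : IsPeriodicSol R u₁) (h₂ : IsPeriodicSol R u₂)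
    (hN₁ : u₁ 0 ∉ N) (hN₂ : u₂ 0 ∉ N) (hne : u₁ 0 ≠ u₂ 0) {τ : ℝ} (hτ : τ ≠ 0)
    (harc : ∀ k ∈ J, 0 < τ * ((u₁ 0 - k) * (u₂ 0 - k))) :
    ∀ k ∈ J, ∀ t ∈ Icc (0:ℝ) 1, R k t = 0 := by
  have h0m : (0:ℝ) ∈ Icc (0:ℝ) 1 := left_mem_Icc.2 zero_le_one
  have hdne : ∀ t ∈ Icc (0:ℝ) 1, u₂ t - u₁ t ≠ 0 := by
    rcases hR.sub_ne_zero_or_eq_zero h₂ h₁ with h | h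
    · exact h
    · exact absurd (sub_eq_zero.1 (h 0 h0m)).symm hne
  have hd := mul_pos_of_continuousOn_of_ne_zero (h₂.continuousOn.sub h₁.continuousOn) hdne
  have hprod : ∀ k ∈ J, ∀ t ∈ Icc (0:ℝ) 1, 0 < τ * ((u₁ t - k) * (u₂ t - k)) := by
    intro k hk t ht
    have hc : ContinuousOn (fun t => τ * ((u₁ t - k) * (u₂ t - k))) (Icc (0:ℝ) 1) :=
      continuousOn_const.mul ((h₁.continuousOn.sub continuousOn_const).mul
        (h₂.continuousOn.sub continuousOn_const))
    have := mul_pos_of_continuousOn_of_ne_zero hc (fun s hs => mul_ne_zero hτ (mul_ne_zero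
      (hR.sub_node_ne_zero h₁ hN₁ (hJN hk) s hs) (hR.sub_node_ne_zero h₂ hN₂ (hJN hk) s hs))) t ht
    exact pos_of_mul_pos_right this (harc k hk).le
  set C : ℝ := σ * τ * (u₂ 0 - u₁ 0) with hC
  have hterm : ∀ k ∈ J, ∀ t ∈ Icc (0:ℝ) 1, ∃ r : ℝ, 0 < r ∧
      C * (nodalWeight N id k * (u₁ t - k)⁻¹ * R k t - nodalWeight N id k * (u₂ t - k)⁻¹ * R k t) =
        r * (σ * (nodalWeight N id k * R k t)) := by
    intro k hk t ht
    have e1 := hR.sub_node_ne_zero h₁ hN₁ (hJN hk) t ht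
    have e2 := hR.sub_node_ne_zero h₂ hN₂ (hJN hk) t ht
    refine ⟨((u₂ 0 - u₁ 0) * (u₂ t - u₁ t)) * τ ^ 2 / (τ * ((u₁ t - k) * (u₂ t - k))),
      div_pos (mul_pos (hd t ht) (by positivity)) (hprod k hk t ht), ?_⟩
    rw [hC]
    field_simp
    ring
  have hnn : ∀ k ∈ N, ∀ t ∈ Icc (0:ℝ) 1, 0 ≤ C * (nodalWeight N id k * (u₁ t - k)⁻¹ * R k t -
      nodalWeight N id k * (u₂ t - k)⁻¹ * R k t) := by
    intro k hk t ht
    by_cases hkJ : k ∈ J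
    · obtain ⟨r, hr, he⟩ := hterm k hkJ t ht
      rw [he]
      exact mul_nonneg hr.le (hR.sign k hk t ht)
    · simp [hJ k hk hkJ t ht]
  have hder : ∀ t ∈ Icc (0:ℝ) 1, HasDerivWithinAt
      (fun s => C * (logPotential N (u₁ s) - logPotential N (u₂ s)))
      (∑ k ∈ N, C * (nodalWeight N id k * (u₁ t - k)⁻¹ * R k t -
        nodalWeight N id k * (u₂ t - k)⁻¹ * R k t)) (Icc (0:ℝ) 1) t := by
    intro t ht
    obtain ⟨c, -, hc⟩ := hR.exists_hasDerivWithinAt_logPotential ht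
    refine (((hc u₁ h₁ hN₁).fun_sub (hc u₂ h₂ hN₂)).const_mul C).congr_deriv ?_
    rw [← Finset.mul_sum, Finset.sum_sub_distrib]
    ring
  have hzero := hasDerivWithinAt_eq_zero_of_nonneg_of_eq hder
    (fun t ht => Finset.sum_nonneg fun k hk => hnn k hk t ht) (by rw [h₁.2, h₂.2])
  intro k hk t ht
  have hk0 := (Finset.sum_eq_zero_iff_of_nonneg fun k hk => hnn k hk t ht).1 (hzero t ht) k
    (hJN hk)
  obtain ⟨r, hr, he⟩ := hterm k hk t ht
  rw [he] at hk0
  have hw : nodalWeight N id k ≠ 0 := nodalWeight_ne_zero (injOn_id _) (hJN hk)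
  simpa [hr.ne', hR.sign_ne_zero, hw] using hk0

/-- If the field vanishes at all nodes, no periodic solution avoiding the nodes is isolated. -/
theorem AlternatingField.not_isIsolatedPeriodicSol (hR : AlternatingField R N σ)
    (hN : ∀ k ∈ N, ∀ t ∈ Icc (0:ℝ) 1, R k t = 0) {u : ℝ → ℝ} (h0 : u 0 ∉ N) :
    ¬ IsIsolatedPeriodicSol R u := by
  rintro ⟨hu, ε, hε, hiso⟩
  have h0m : (0:ℝ) ∈ Icc (0:ℝ) 1 := left_mem_Icc.2 zero_le_one
  set F := logPotential N
  set O : Set ℝ := {y | ∀ k ∈ N, 0 < (u 0 - k) * (y - k)} with hO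
  have hOpen : IsOpen O := by
    have : O = ⋂ k ∈ N, {y | 0 < (u 0 - k) * (y - k)} := by ext; simp [hO]
    rw [this]
    exact isOpen_biInter_finset fun k _ => isOpen_lt continuous_const (by fun_prop)
  have hOrd : ∀ x ∈ O, ∀ y ∈ O, ∀ z ∈ Icc x y, z ∈ O := by
    intro x hx y hy z hz k hk
    have h1 := hx k hk
    have h2 := hy k hk
    rcases pos_and_pos_or_neg_and_neg_of_mul_pos h1 with ⟨p, q⟩ | ⟨p, q⟩
    · exact mul_pos p (by linarith [hz.1])
    · have hy' : y - k < 0 := by nlinarith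
      exact mul_pos_of_neg_of_neg p (by linarith [hz.2])
  have hON : ∀ y ∈ O, y ∉ N := fun y hy hyN => by simpa using hy y hyN
  have hQ : ∀ y ∈ O, ((nodal N (id : ℝ → ℝ)).eval y)⁻¹ ≠ 0 := by
    intro y hy
    rw [eval_nodal]
    refine inv_ne_zero (Finset.prod_ne_zero_iff.2 fun k hk h => hON y hy ?_)
    rwa [sub_eq_zero.1 h]
  have hF : ∀ y ∈ O, HasStrictDerivAt F ((nodal N id).eval y)⁻¹ y :=
    fun y hy => hasStrictDerivAt_logPotential hR.nonempty (hON y hy)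
  have hlt : ∀ x ∈ O, ∀ y ∈ O, x < y → F x ≠ F y := by
    intro x hx y hy hxy he
    obtain ⟨z, hz, hz0⟩ := exists_hasDerivAt_eq_zero hxy
      (fun z hz => (hF z (hOrd x hx y hy z hz)).hasDerivAt.continuousAt.continuousWithinAt) he
      (fun z hz => (hF z (hOrd x hx y hy z (Ioo_subset_Icc_self hz))).hasDerivAt)
    exact hQ z (hOrd x hx y hy z (Ioo_subset_Icc_self hz)) hz0
  have hinj : InjOn F O := by
    intro x hx y hy he
    rcases lt_trichotomy x y with h | h | h
    · exact absurd he (hlt x hx y hy h)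
    · exact h
    · exact absurd he.symm (hlt y hy x hx h)
  set G := Function.invFunOn F O
  have hGF : ∀ y ∈ O, G (F y) = y := hinj.leftInvOn_invFunOn
  have hG : ∀ y ∈ O, HasDerivAt G ((nodal N id).eval y) (F y) := fun y hy => by
    simpa using hasDerivAt_invFunOn hOpen hinj hy (hF y hy) (hQ y hy)
  have huO : ∀ t ∈ Icc (0:ℝ) 1, u t ∈ O := fun t ht k hk =>
    mul_pos_of_continuousOn_of_ne_zero (hu.continuousOn.sub continuousOn_const)
      (hR.sub_node_ne_zero hu h0 hk) t ht
  have himOpen : IsOpen (F '' O) := by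
    rw [isOpen_iff_mem_nhds]
    rintro _ ⟨y, hy, rfl⟩
    rw [← (hF y hy).map_nhds_eq (hQ y hy)]
    exact Filter.image_mem_map (hOpen.mem_nhds hy)
  have hcont : ContinuousOn (fun t => F (u t)) (Icc (0:ℝ) 1) := fun t ht =>
    (hF _ (huO t ht)).hasDerivAt.continuousAt.comp_continuousWithinAt (hu.continuousOn t ht)
  obtain ⟨δ, hδ, hthick⟩ := (isCompact_Icc.image_of_continuousOn hcont).exists_thickening_subset_open
    himOpen (by rintro _ ⟨t, ht, rfl⟩; exact ⟨u t, huO t ht, rfl⟩)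
  have hshift : ∀ s, |s| < δ → ∀ t ∈ Icc (0:ℝ) 1, ∃ z ∈ O, F z = F (u t) + s := by
    intro s hs t ht
    exact hthick (Metric.mem_thickening_iff.2 ⟨F (u t), ⟨t, ht, rfl⟩, by simpa using hs⟩)
  have hper : ∀ s, |s| < δ → IsPeriodicSol R (fun t => G (F (u t) + s)) := by
    refine fun s hs => ⟨fun t ht => ?_, by simp only [hu.2]⟩
    obtain ⟨c, hfrac, hc⟩ := hR.exists_hasDerivWithinAt_logPotential ht
    have hsum : ∀ y : ℝ, ∑ k ∈ N, nodalWeight N id k * (y - k)⁻¹ * R k t = 0 := fun y =>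
      Finset.sum_eq_zero fun k hk => by rw [hN k hk t ht, mul_zero]
    obtain ⟨z, hz, he⟩ := hshift s hs t ht
    have hd := (hc u hu h0).add_const s
    rw [hsum, add_zero] at hd
    have hGz := hG z hz
    rw [he] at hGz
    have hcomp := hGz.comp_hasDerivWithinAt t hd
    have hRz := hfrac z (hON z hz)
    rw [hsum, add_zero] at hRz
    refine hcomp.congr_deriv ?_
    beta_reduce
    rw [← he, hGF z hz, ← hRz]
    have : (nodal N (id : ℝ → ℝ)).eval z ≠ 0 := fun h => hQ z hz (by rw [h, inv_zero])
    field_simp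
  have hlim : ∀ᶠ s in nhds (0:ℝ), |G (F (u 0) + s) - u 0| < ε := by
    have hca : ContinuousAt (fun s => |G (F (u 0) + s) - u 0|) 0 := by
      have h1 : ContinuousAt G (F (u 0) + 0) := by
        rw [add_zero]; exact (hG _ (huO 0 h0m)).continuousAt
      have h2 : ContinuousAt (fun s => G (F (u 0) + s)) 0 :=
        ContinuousAt.comp (f := fun s => F (u 0) + s) h1 (by fun_prop)
      exact (h2.sub continuousAt_const).abs
    refine hca.eventually_lt_const ?_
    simpa [hGF _ (huO 0 h0m)] using hε
  obtain ⟨η, hη, hball⟩ := Metric.eventually_nhds_iff.1 hlim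
  set s := min η δ / 2
  have hs : 0 < s := half_pos (lt_min hη hδ)
  have hsη : s < η := (half_lt_self (lt_min hη hδ)).trans_le (min_le_left _ _)
  have hsδ : |s| < δ := by
    rw [abs_of_pos hs]
    exact (half_lt_self (lt_min hη hδ)).trans_le (min_le_right _ _)
  have heq := hiso _ (hper s hsδ) (hball (by simpa [abs_of_pos hs] using hsη))
  obtain ⟨z, hz, he⟩ := hshift s hsδ 0 h0m
  simp only [← he, hGF z hz] at heq
  rw [heq] at he
  linarith

/-- A set of reals avoiding `J ⊆ N` that has at most one point off `N` on each arc of the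
projective line minus `J` has at most `N.card` points. -/
theorem exists_finset_card_le_of_arcs {N J : Finset ℝ} (hJN : J ⊆ N) (hJ : J.Nonempty)
    {A : Set ℝ} (hAJ : ∀ x ∈ A, x ∉ J)
    (harc : ∀ x ∈ A, ∀ y ∈ A, x ∉ N → y ∉ N → ((∀ k ∈ J, 0 < (x - k) * (y - k)) ∨
      ∀ k ∈ J, (x - k) * (y - k) < 0) → x = y) :
    ∃ F : Finset ℝ, F.card ≤ N.card ∧ A ⊆ F := by
  classical
  let left : ℝ → ℝ := fun x =>
    if h : (J.filter (· < x)).Nonempty then (J.filter (· < x)).max' h else J.max' hJ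
  have hleftJ : ∀ x, left x ∈ J := by
    intro x
    by_cases h : (J.filter (· < x)).Nonempty
    · simp only [left, dif_pos h]
      exact Finset.filter_subset _ _ (Finset.max'_mem _ h)
    · simp only [left, dif_neg h]
      exact Finset.max'_mem _ _
  have hpos : ∀ x, (J.filter (· < x)).Nonempty → left x < x ∧ ∀ k ∈ J, k < x → k ≤ left x := by
    intro x h
    simp only [left, dif_pos h]
    exact ⟨(Finset.mem_filter.1 (Finset.max'_mem _ h)).2,
      fun k hk hkx => Finset.le_max' _ _ (Finset.mem_filter.2 ⟨hk, hkx⟩)⟩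
  have hneg : ∀ x, ¬ (J.filter (· < x)).Nonempty →
      (∀ k ∈ J, x ≤ k) ∧ ∀ k ∈ J, k ≤ left x := by
    intro x h
    refine ⟨fun k hk => ?_, fun k hk => ?_⟩
    · by_contra! hlt
      exact h ⟨k, Finset.mem_filter.2 ⟨hk, hlt⟩⟩
    · simp only [left, dif_neg h]
      exact Finset.le_max' _ _ hk
  let label : ℝ → ℝ := fun x => if x ∈ N then x else left x
  have hmaps : ∀ x ∈ A, label x ∈ (N : Set ℝ) := by
    intro x _
    by_cases h : x ∈ N
    · simp [label, h]
    · simpa [label, h] using hJN (hleftJ x)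
  have hinj : InjOn label A := by
    intro x hx y hy he
    by_cases hxN : x ∈ N <;> by_cases hyN : y ∈ N <;>
      simp only [label, hxN, hyN, if_true, if_false] at he
    · exact he
    · exact absurd (he ▸ hleftJ y) (hAJ x hx)
    · exact absurd (he ▸ hleftJ x) (hAJ y hy)
    · refine harc x hx y hy hxN hyN ?_
      have hxne : ∀ k ∈ J, k ≠ x := fun k hk h => hAJ x hx (h ▸ hk)
      have hyne : ∀ k ∈ J, k ≠ y := fun k hk h => hAJ y hy (h ▸ hk)
      by_cases h1 : (J.filter (· < x)).Nonempty <;> by_cases h2 : (J.filter (· < y)).Nonempty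
      · left
        intro k hk
        obtain ⟨a1, b1⟩ := hpos x h1
        obtain ⟨a2, b2⟩ := hpos y h2
        rcases le_or_gt k (left x) with h | h
        · exact mul_pos (by linarith) (by linarith)
        · have hkx : x < k := lt_of_le_of_ne (not_lt.1 fun h' => by linarith [b1 k hk h'])
            (hxne k hk).symm
          have hky : y < k := lt_of_le_of_ne (not_lt.1 fun h' => by linarith [b2 k hk h'])
            (hyne k hk).symm
          exact mul_pos_of_neg_of_neg (by linarith) (by linarith)
      · right
        intro k hk
        have a2 := (hneg y h2).2 k hk
        have hky := lt_of_le_of_ne ((hneg y h2).1 k hk) (hyne k hk).symm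
        exact mul_neg_of_pos_of_neg (by linarith [(hpos x h1).1]) (by linarith)
      · right
        intro k hk
        have a1 := (hneg x h1).2 k hk
        have hkx := lt_of_le_of_ne ((hneg x h1).1 k hk) (hxne k hk).symm
        exact mul_neg_of_neg_of_pos (by linarith) (by linarith [(hpos y h2).1])
      · left
        intro k hk
        have hkx := lt_of_le_of_ne ((hneg x h1).1 k hk) (hxne k hk).symm
        have hky := lt_of_le_of_ne ((hneg y h2).1 k hk) (hyne k hk).symm
        exact mul_pos_of_neg_of_neg (by linarith) (by linarith)
  have hfin : A.Finite := Set.Finite.of_injOn hmaps hinj N.finite_toSet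
  refine ⟨hfin.toFinset, Finset.card_le_card_of_injOn label
    (fun x hx => hmaps x (by simpa using hx))
    (by simpa using hinj), by simp⟩

theorem AlternatingField.exists_finset_card_le (hR : AlternatingField R N σ) :
    ∃ F : Finset ℝ, F.card ≤ N.card ∧
      {y : ℝ | ∃ u : ℝ → ℝ, IsIsolatedPeriodicSol R u ∧ u 0 = y} ⊆ (F : Set ℝ) := by
  classical
  set J := N.filter fun k => ∃ t ∈ Icc (0:ℝ) 1, R k t ≠ 0 with hJdef
  have hJN : J ⊆ N := Finset.filter_subset _ _
  have hJ : ∀ k ∈ N, k ∉ J → ∀ t ∈ Icc (0:ℝ) 1, R k t = 0 := by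
    intro k hk hkJ t ht
    by_contra h
    exact hkJ (Finset.mem_filter.2 ⟨hk, t, ht, h⟩)
  rcases J.eq_empty_or_nonempty with hJe | hJne
  · refine ⟨N, le_rfl, ?_⟩
    rintro _ ⟨u, hu, rfl⟩
    by_contra h0
    exact hR.not_isIsolatedPeriodicSol (fun k hk => hJ k hk (by simp [hJe])) h0 hu
  · refine exists_finset_card_le_of_arcs hJN hJne ?_ ?_
    · rintro _ ⟨u, hu, rfl⟩ hmem
      obtain ⟨hm, t, ht, hne⟩ := Finset.mem_filter.1 hmem
      exact hne (hR.field_eq_zero_of_start_mem hu.1 hm t ht)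
    · rintro _ ⟨u, hu, rfl⟩ _ ⟨v, hv, rfl⟩ hu0 hv0 harc
      by_contra hne
      obtain ⟨τ, hτ, hpos⟩ : ∃ τ : ℝ, τ ≠ 0 ∧ ∀ k ∈ J, 0 < τ * ((u 0 - k) * (v 0 - k)) := by
        rcases harc with h | h
        · exact ⟨1, one_ne_zero, fun k hk => by simpa using h k hk⟩
        · exact ⟨-1, by norm_num, fun k hk => by linarith [h k hk]⟩
      obtain ⟨k, hk⟩ := hJne
      obtain ⟨-, t, ht, hkt⟩ := Finset.mem_filter.1 hk
      exact hkt (hR.field_eq_zero_of_same_arc hJN hJ hu.1 hv.1 hu0 hv0 hne hτ hpos k hk t ht)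

end AlternatingField

section NodalSigns

open Lagrange

/-- The nodal weights of an increasing family of nodes alternate in sign. -/
theorem nodalWeight_image_sign {m : ℕ} {lam : ℕ → ℝ}
    (hlt : ∀ i j, 1 ≤ i → i < j → j ≤ m → lam i < lam j) {i : ℕ} (hi : i ∈ Finset.Icc 1 m) :
    0 < (-1:ℝ) ^ (m + i) * nodalWeight ((Finset.Icc 1 m).image lam) id (lam i) := by
  have hinj : InjOn lam (Finset.Icc 1 m : Finset ℕ) := by
    intro p hp q hq he
    rw [Finset.mem_coe, Finset.mem_Icc] at hp hq
    rcases lt_trichotomy p q with h | h | h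
    · exact absurd he (hlt p q hp.1 h hq.2).ne
    · exact h
    · exact absurd he (hlt q p hq.1 h hp.2).ne'
  have hi' := Finset.mem_Icc.1 hi
  have herase : ((Finset.Icc 1 m).image lam).erase (lam i) =
      (Finset.Ico 1 i ∪ Finset.Ioc i m).image lam := by
    ext y
    simp only [Finset.mem_erase, Finset.mem_image, Finset.mem_union, Finset.mem_Ico,
      Finset.mem_Ioc, Finset.mem_Icc]
    constructor
    · rintro ⟨hne, j, hj, rfl⟩
      have : j ≠ i := fun h => hne (by rw [h])
      exact ⟨j, by omega, rfl⟩
    · rintro ⟨j, hj, rfl⟩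
      refine ⟨fun h => ?_, j, by omega, rfl⟩
      have := hinj (Finset.mem_coe.2 (Finset.mem_Icc.2 (by omega))) (Finset.mem_coe.2 hi) h
      omega
  have hdisj : Disjoint (Finset.Ico 1 i) (Finset.Ioc i m) := by
    rw [Finset.disjoint_left]
    intro j hj hj'
    simp only [Finset.mem_Ico, Finset.mem_Ioc] at hj hj'
    omega
  have hpow : (-1:ℝ) ^ (m + i) = (-1) ^ (m - i) := by
    have : m + i = (m - i) + 2 * i := by omega
    rw [this, pow_add, pow_mul]
    simp
  have hupper : ∏ j ∈ Finset.Ioc i m, (lam i - lam j)⁻¹ =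
      (-1) ^ (m - i) * ∏ j ∈ Finset.Ioc i m, (lam j - lam i)⁻¹ := by
    rw [← Nat.card_Ioc, ← Finset.prod_const, ← Finset.prod_mul_distrib]
    refine Finset.prod_congr rfl fun j _ => ?_
    rw [← neg_sub, inv_neg, neg_one_mul]
  have hw : nodalWeight ((Finset.Icc 1 m).image lam) id (lam i) =
      (∏ j ∈ Finset.Ico 1 i, (lam i - lam j)⁻¹) *
        ((-1) ^ (m - i) * ∏ j ∈ Finset.Ioc i m, (lam j - lam i)⁻¹) := by
    rw [nodalWeight, herase, Finset.prod_image, Finset.prod_union hdisj, ← hupper]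
    · rfl
    · intro p hp q hq he
      simp only [Finset.coe_union, Finset.coe_Ico, Finset.coe_Ioc, mem_union, mem_Ico,
        mem_Ioc] at hp hq
      exact hinj (Finset.mem_coe.2 (Finset.mem_Icc.2 (by omega)))
        (Finset.mem_coe.2 (Finset.mem_Icc.2 (by omega))) he
  have hA : 0 < ∏ j ∈ Finset.Ico 1 i, (lam i - lam j)⁻¹ := Finset.prod_pos fun j hj => by
    have hj := Finset.mem_Ico.1 hj
    exact inv_pos.2 (sub_pos.2 (hlt j i hj.1 hj.2 hi'.2))
  have hB : 0 < ∏ j ∈ Finset.Ioc i m, (lam j - lam i)⁻¹ := Finset.prod_pos fun j hj => by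
    have hj := Finset.mem_Ioc.1 hj
    exact inv_pos.2 (sub_pos.2 (hlt i j hi'.1 hj.1 hj.2))
  have hsq : (-1:ℝ) ^ (m - i) * (-1) ^ (m - i) = 1 := by
    rw [← mul_pow]; simp
  rw [hpow, hw]
  calc (0:ℝ) < _ * _ := mul_pos hA hB
    _ = ((-1:ℝ) ^ (m - i) * (-1) ^ (m - i)) * _ := by rw [hsq, one_mul]
    _ = _ := by ring

end NodalSigns

section ChangeOfVariables

variable {S : ℝ → ℝ → ℝ} {a b a' b' : ℝ → ℝ}

theorem isPeriodicSol_affine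
    (ha' : ∀ t ∈ Icc (0:ℝ) 1, HasDerivWithinAt a (a' t) (Icc (0:ℝ) 1) t)
    (hb' : ∀ t ∈ Icc (0:ℝ) 1, HasDerivWithinAt b (b' t) (Icc (0:ℝ) 1) t)
    (haper : a 0 = a 1) (hbper : b 0 = b 1) (hapos : ∀ t ∈ Icc (0:ℝ) 1, 0 < a t) {u : ℝ → ℝ}
    (hu : IsPeriodicSol (fun y t => (S (y * a t + b t) t - y * a' t - b' t) / a t) u) :
    IsPeriodicSol S (fun t => u t * a t + b t) := by
  refine ⟨fun t ht => ?_, by simp only [hu.2, haper, hbper]⟩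
  refine (((hu.1 t ht).fun_mul (ha' t ht)).fun_add (hb' t ht)).congr_deriv ?_
  have := (hapos t ht).ne'
  field_simp
  ring

theorem isPeriodicSol_of_affine
    (ha' : ∀ t ∈ Icc (0:ℝ) 1, HasDerivWithinAt a (a' t) (Icc (0:ℝ) 1) t)
    (hb' : ∀ t ∈ Icc (0:ℝ) 1, HasDerivWithinAt b (b' t) (Icc (0:ℝ) 1) t)
    (haper : a 0 = a 1) (hbper : b 0 = b 1) (hapos : ∀ t ∈ Icc (0:ℝ) 1, 0 < a t) {x : ℝ → ℝ}
    (hx : IsPeriodicSol S x) :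
    IsPeriodicSol (fun y t => (S (y * a t + b t) t - y * a' t - b' t) / a t)
      (fun t => (x t - b t) / a t) := by
  refine ⟨fun t ht => ?_, by simp only [hx.2, haper, hbper]⟩
  have hne := (hapos t ht).ne'
  refine (((hx.1 t ht).fun_sub (hb' t ht)).fun_div (ha' t ht) hne).congr_deriv ?_
  have : (x t - b t) / a t * a t + b t = x t := by field_simp; ring
  simp only [this]
  field_simp
  ring

theorem isIsolatedPeriodicSol_of_affine
    (ha' : ∀ t ∈ Icc (0:ℝ) 1, HasDerivWithinAt a (a' t) (Icc (0:ℝ) 1) t)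
    (hb' : ∀ t ∈ Icc (0:ℝ) 1, HasDerivWithinAt b (b' t) (Icc (0:ℝ) 1) t)
    (haper : a 0 = a 1) (hbper : b 0 = b 1) (hapos : ∀ t ∈ Icc (0:ℝ) 1, 0 < a t) {x : ℝ → ℝ}
    (hx : IsIsolatedPeriodicSol S x) :
    IsIsolatedPeriodicSol (fun y t => (S (y * a t + b t) t - y * a' t - b' t) / a t)
      (fun t => (x t - b t) / a t) := by
  obtain ⟨hx, ε, hε, hiso⟩ := hx
  have ha0 := hapos 0 (left_mem_Icc.2 zero_le_one)
  refine ⟨isPeriodicSol_of_affine ha' hb' haper hbper hapos hx, ε / a 0, div_pos hε ha0,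
    fun y hy hlt => ?_⟩
  have heq : y 0 * a 0 + b 0 - x 0 = (y 0 - (x 0 - b 0) / a 0) * a 0 := by field_simp; ring
  have h := hiso _ (isPeriodicSol_affine ha' hb' haper hbper hapos hy) (by
    simp only [heq, abs_mul, abs_of_pos ha0]
    rwa [lt_div_iff₀ ha0] at hlt)
  beta_reduce at h
  rw [eq_div_iff ha0.ne']
  linarith

/-- Divided differences of a polynomial field with continuous coefficients are continuous. -/
theorem exists_continuousOn_divided_difference {m : ℕ} {aco : ℕ → ℝ → ℝ}
    (haco : ∀ i ≤ m, ContinuousOn (aco i) (Icc (0:ℝ) 1))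
    (hS : ∀ x t, S x t = ∑ i ∈ Finset.range (m + 1), aco i t * x ^ i) {x y : ℝ → ℝ}
    (hx : ContinuousOn x (Icc (0:ℝ) 1)) (hy : ContinuousOn y (Icc (0:ℝ) 1)) :
    ∃ h : ℝ → ℝ, ContinuousOn h (Icc (0:ℝ) 1) ∧
      ∀ t, S (x t) t - S (y t) t = h t * (x t - y t) := by
  refine ⟨fun t => ∑ i ∈ Finset.range (m + 1),
    aco i t * ∑ j ∈ Finset.range i, x t ^ j * y t ^ (i - 1 - j), ?_, fun t => ?_⟩
  · exact continuousOn_finsetSum _ fun i hi =>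
      (haco i (Finset.mem_range_succ_iff.1 hi)).mul (continuousOn_finsetSum _ fun j _ =>
        (hx.pow j).mul (hy.pow _))
  · rw [hS, hS, ← Finset.sum_sub_distrib, Finset.sum_mul]
    refine Finset.sum_congr rfl fun i _ => ?_
    rw [mul_assoc, geom_sum₂_mul, mul_sub]

open Polynomial in
theorem exists_polynomial_affine {m : ℕ} (hm : 1 ≤ m) {aco : ℕ → ℝ → ℝ}
    (hS : ∀ x t, S x t = ∑ i ∈ Finset.range (m + 1), aco i t * x ^ i) (t : ℝ) :
    ∃ p : ℝ[X], p.natDegree ≤ m ∧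
      ∀ y, (S (y * a t + b t) t - y * a' t - b' t) / a t = p.eval y := by
  refine ⟨C (a t)⁻¹ * (∑ i ∈ Finset.range (m + 1), C (aco i t) * (C (a t) * X + C (b t)) ^ i -
    (C (a' t) * X + C (b' t))), ?_, fun y => ?_⟩
  · refine (natDegree_C_mul_le _ _).trans ((natDegree_sub_le_of_le (n := m)
      (natDegree_sum_le_of_forall_le _ _ fun i hi => ?_)
      (natDegree_linear_le.trans hm)).trans_eq (max_self m))
    refine (natDegree_C_mul_le _ _).trans ((natDegree_pow_le_of_le i natDegree_linear_le).trans ?_)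
    rw [mul_one]
    exact Finset.mem_range_succ_iff.1 hi
  · simp only [hS, eval_mul, eval_C, eval_sub, eval_finsetSum, eval_pow, eval_add, eval_X]
    rw [div_eq_inv_mul]
    congr 1
    have : ∀ i, (a t * y + b t) ^ i = (y * a t + b t) ^ i := fun i => by rw [mul_comm]
    simp only [this]
    ring

end ChangeOfVariables

/-- Theorem 1.4: under the geometric Hypothesis (H'), stated via the determinant
function `D lam t = S (lam * a t + b t) t - lam * a' t - b' t`, the generalized Abel
equation has at most `m` isolated periodic solutions. -/
theorem abel_Hprime_at_most_m (m : ℕ) (hm : 1 ≤ m) (aco : ℕ → ℝ → ℝ)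
    (haco : ∀ i ≤ m, ContDiffOn ℝ (⊤ : ℕ∞) (aco i) (Set.Icc (0:ℝ) 1))
    (S : ℝ → ℝ → ℝ)
    (hS : ∀ x t, S x t = ∑ i ∈ Finset.range (m + 1), aco i t * x ^ i)
    (a b a' b' : ℝ → ℝ)
    (haS : ContDiffOn ℝ (⊤ : ℕ∞) a (Set.Icc (0:ℝ) 1))
    (hbS : ContDiffOn ℝ (⊤ : ℕ∞) b (Set.Icc (0:ℝ) 1))
    (ha' : ∀ t ∈ Set.Icc (0:ℝ) 1, HasDerivWithinAt a (a' t) (Set.Icc (0:ℝ) 1) t)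
    (hb' : ∀ t ∈ Set.Icc (0:ℝ) 1, HasDerivWithinAt b (b' t) (Set.Icc (0:ℝ) 1) t)
    (haper : a 0 = a 1) (hbper : b 0 = b 1)
    (hapos : ∀ t ∈ Set.Icc (0:ℝ) 1, 0 < a t)
    (D : ℝ → ℝ → ℝ)
    (hD : ∀ lam t, D lam t = S (lam * a t + b t) t - lam * a' t - b' t)
    (lam : ℕ → ℝ)
    (hlt : ∀ i j, 1 ≤ i → i < j → j ≤ m → lam i < lam j)
    (hsign : (∀ i, 1 ≤ i → i ≤ m → ∀ t ∈ Set.Icc (0:ℝ) 1, 0 ≤ (-1:ℝ) ^ i * D (lam i) t) ∨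
             (∀ i, 1 ≤ i → i ≤ m → ∀ t ∈ Set.Icc (0:ℝ) 1, (-1:ℝ) ^ i * D (lam i) t ≤ 0)) :
    ∃ F : Finset ℝ, F.card ≤ m ∧
      {x0 : ℝ | ∃ x : ℝ → ℝ, IsIsolatedPeriodicSol S x ∧ x 0 = x0} ⊆ (F : Set ℝ) := by
  set R : ℝ → ℝ → ℝ := fun y t => (S (y * a t + b t) t - y * a' t - b' t) / a t with hRdef
  set N : Finset ℝ := (Finset.Icc 1 m).image lam with hN
  have hcard : N.card = m := by
    rw [hN, Finset.card_image_of_injOn, Nat.card_Icc, Nat.add_sub_cancel]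
    intro p hp q hq he
    rw [Finset.mem_coe, Finset.mem_Icc] at hp hq
    rcases lt_trichotomy p q with h | h | h
    · exact absurd he (hlt p q hp.1 h hq.2).ne
    · exact h
    · exact absurd he (hlt q p hq.1 h hp.2).ne'
  have ha'c : ContinuousOn a' (Icc (0:ℝ) 1) :=
    (haS.continuousOn_derivWithin uniqueDiffOn_Icc_zero_one (by exact_mod_cast le_top)).congr
      fun t ht => ((ha' t ht).derivWithin (uniqueDiffOn_Icc_zero_one t ht)).symm
  obtain ⟨ρ, hρ, hρs⟩ : ∃ ρ : ℝ, ρ ≠ 0 ∧ ∀ i, 1 ≤ i → i ≤ m → ∀ t ∈ Icc (0:ℝ) 1,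
      0 ≤ ρ * ((-1:ℝ) ^ i * D (lam i) t) := by
    rcases hsign with h | h
    · exact ⟨1, one_ne_zero, fun i h1 h2 t ht => by simpa using h i h1 h2 t ht⟩
    · exact ⟨-1, by norm_num, fun i h1 h2 t ht => by linarith [h i h1 h2 t ht]⟩
  have hR : AlternatingField R N (ρ * (-1) ^ m) := by
    refine ⟨⟨lam 1, Finset.mem_image_of_mem _ (Finset.mem_Icc.2 ⟨le_rfl, hm⟩)⟩, ?_, ?_,
      mul_ne_zero hρ (pow_ne_zero _ (by norm_num)), ?_⟩
    · intro x y hx hy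
      obtain ⟨h, hc, hh⟩ := exists_continuousOn_divided_difference
        (fun i hi => (haco i hi).continuousOn) hS
        ((hx.mul haS.continuousOn).add hbS.continuousOn)
        ((hy.mul haS.continuousOn).add hbS.continuousOn)
      refine ⟨fun t => h t - a' t / a t, hc.sub (ha'c.div haS.continuousOn
        fun t ht => (hapos t ht).ne'), fun t ht => ?_⟩
      have hne := (hapos t ht).ne'
      have hht := hh t
      simp only [Pi.add_apply, Pi.mul_apply] at hht
      simp only [hRdef]
      generalize S (x t * a t + b t) t = p at hht ⊢
      generalize S (y t * a t + b t) t = q at hht ⊢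
      field_simp
      linear_combination hht
    · intro t _
      rw [hcard]
      exact exists_polynomial_affine hm hS t
    · intro k hk t ht
      obtain ⟨i, hi, rfl⟩ := Finset.mem_image.1 hk
      have hw := nodalWeight_image_sign hlt hi
      have hi' := Finset.mem_Icc.1 hi
      have hs := hρs i hi'.1 hi'.2 t ht
      have hRD : R (lam i) t = D (lam i) t / a t := by simp only [hRdef, hD]
      have hsq : (-1:ℝ) ^ i * (-1) ^ i = 1 := by rw [← mul_pow]; simp
      have hprod := div_nonneg (mul_nonneg hw.le hs) (hapos t ht).le
      rw [hRD]
      refine hprod.trans_eq ?_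
      rw [pow_add]
      linear_combination (ρ * (-1) ^ m * Lagrange.nodalWeight N id (lam i) * D (lam i) t / a t) * hsq
  obtain ⟨F, hF, hsub⟩ := hR.exists_finset_card_le
  refine ⟨F.image fun y => y * a 0 + b 0, Finset.card_image_le.trans (hF.trans hcard.le), ?_⟩
  rintro _ ⟨x, hx, rfl⟩
  have hu := isIsolatedPeriodicSol_of_affine ha' hb' haper hbper hapos hx
  have hne := (hapos 0 (left_mem_Icc.2 zero_le_one)).ne'
  refine Finset.mem_coe.2 (Finset.mem_image.2 ⟨_, hsub ⟨_, hu, rfl⟩, ?_⟩)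
  field_simp
  ring
end

section
/- Let \lambda_1 < \cdots < \lambda_m be real numbers. Assume that v_S is transverse to the curves \gamma_{\lambda_1}, \ldots, \gamma_{\lambda_m}, i.e., D_{\lambda_i}(t) \ne 0 for all t \in [0,1] and all i, and that for each i = 1, \ldots, m-1 the pairs \{v_S, \dot{\gamma}_{\lambda_i}\} and \{v_S, \dot{\gamma}_{\lambda_{i+1}}\} have opposite orientations, i.e., D_{\lambda_i}(t) \cdot D_{\lambda_{i+1}}(s) < 0 for all t, s \in [0,1]. Then equation (1) has at most m isolated periodic solutions; precisely, the set of real numbers x_0 such that the solution of (1) with initial value x(0) = x_0 is a periodic solution and is isolated has at most m elements. -/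
open Set

/-- A nowhere vanishing continuous function on a compact interval has constant sign. -/
theorem ContinuousOn.mul_pos_of_ne_zero_on_Icc {f : ℝ → ℝ} {a b : ℝ}
    (hf : ContinuousOn f (Icc a b)) (h0 : ∀ t ∈ Icc a b, f t ≠ 0)
    {t u : ℝ} (ht : t ∈ Icc a b) (hu : u ∈ Icc a b) : 0 < f t * f u := by
  by_contra! hneg
  have hivt : uIcc (f t) (f u) ⊆ f '' uIcc t u :=
    intermediate_value_uIcc (hf.mono (ordConnected_Icc.uIcc_subset ht hu))
  have hmem : (0 : ℝ) ∈ uIcc (f t) (f u) := by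
    rcases mul_nonpos_iff.1 hneg with ⟨h1, h2⟩ | ⟨h1, h2⟩
    · exact mem_uIcc.2 (Or.inr ⟨h2, h1⟩)
    · exact mem_uIcc.2 (Or.inl ⟨h1, h2⟩)
  obtain ⟨c, hc, hc0⟩ := hivt hmem
  exact h0 c (ordConnected_Icc.uIcc_subset ht hu hc) hc0

/-- If a function with nonpositive derivative takes equal values at the endpoints of an interval,
then its derivative vanishes identically. -/
theorem hasDerivWithinAt_eq_zero_of_nonpos_of_eq {f f' : ℝ → ℝ} {a b : ℝ} (hab : a < b)
    (hf : ∀ t ∈ Icc a b, HasDerivWithinAt f (f' t) (Icc a b) t)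
    (hf' : ∀ t ∈ Icc a b, f' t ≤ 0) (hend : f a = f b) {t : ℝ} (ht : t ∈ Icc a b) :
    f' t = 0 := by
  have hanti : AntitoneOn f (Icc a b) :=
    antitoneOn_of_hasDerivWithinAt_nonpos (convex_Icc a b)
      (fun t ht => (hf t ht).continuousWithinAt)
      (fun t ht => (hf t (interior_subset ht)).mono interior_subset)
      (fun t ht => hf' t (interior_subset ht))
  have hconst : ∀ u ∈ Icc a b, f u = f a := fun u hu =>
    le_antisymm (hanti (left_mem_Icc.2 hab.le) hu hu.1)
      (hend ▸ hanti hu (right_mem_Icc.2 hab.le) hu.2)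
  have hzero : HasDerivWithinAt f 0 (Icc a b) t :=
    (hasDerivWithinAt_const t (Icc a b) (f a)).congr hconst (hconst t ht)
  exact (uniqueDiffOn_Icc hab t ht).eq_deriv _ (hf t ht) hzero

/-- A function with equal values at the endpoints of an interval and positive derivative at each of
its zeros has no zeros. -/
theorem ne_zero_of_endpoints_eq_of_deriv_pos {f f' : ℝ → ℝ} {a b : ℝ} (hab : a < b)
    (hf : ∀ t ∈ Icc a b, HasDerivWithinAt f (f' t) (Icc a b) t)
    (hpos : ∀ t ∈ Icc a b, f t = 0 → 0 < f' t) (hend : f a = f b) :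
    ∀ t ∈ Icc a b, f t ≠ 0 := by
  have hcont : ContinuousOn f (Icc a b) := fun t ht => (hf t ht).continuousWithinAt
  have hforward : ∀ c ∈ Icc a b, 0 ≤ f c → ∀ t ∈ Icc c b, 0 ≤ f t := by
    intro c hc hfc
    refine image_le_of_deriv_right_lt_deriv_boundary' (f := fun _ => 0) (f' := fun _ => 0)
      (B' := f') continuousOn_const (fun x _ => hasDerivWithinAt_const _ _ _) hfc
      (hcont.mono (Icc_subset_Icc_left hc.1)) (fun x hx => ?_) (fun x hx h => ?_)
    · exact (hf x ⟨hc.1.trans hx.1, hx.2.le⟩).mono_of_mem_nhdsWithin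
        (Icc_mem_nhdsGE_of_mem ⟨hc.1.trans hx.1, hx.2⟩)
    · exact hpos x ⟨hc.1.trans hx.1, hx.2.le⟩ h.symm
  intro c hc hfc
  have hb : 0 ≤ f b := hforward c hc hfc.ge b (right_mem_Icc.2 hc.2)
  have hnonneg : ∀ t ∈ Icc a b, 0 ≤ f t :=
    hforward a (left_mem_Icc.2 hab.le) (hend ▸ hb)
  have hleft : ∀ d ∈ Ioc a b, f d ≠ 0 := by
    intro d hd hfd
    have hd' : d ∈ Icc a b := Ioc_subset_Icc_self hd
    have hslope := hasDerivWithinAt_iff_tendsto_slope'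
      (s := Ico a d) (by simp) |>.1 ((hf d hd').mono fun t ht => ⟨ht.1, ht.2.le.trans hd.2⟩)
    have := right_nhdsWithin_Ico_neBot hd.1
    refine (hpos d hd' hfd).not_ge (le_of_tendsto hslope ?_)
    filter_upwards [self_mem_nhdsWithin] with t ht
    rw [slope_def_field, hfd, sub_zero]
    exact div_nonpos_of_nonneg_of_nonpos (hnonneg t ⟨ht.1, ht.2.le.trans hd.2⟩)
      (sub_nonpos.2 ht.2.le)
  rcases hc.1.eq_or_lt with rfl | hac
  · exact hleft b ⟨hab, le_rfl⟩ (hend ▸ hfc)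
  · exact hleft c ⟨hac, hc.2⟩ hfc

namespace Lagrange

open Polynomial

variable {ι : Type*} [DecidableEq ι] {s : Finset ι} {v : ι → ℝ}

/-- Barycentric form of a polynomial whose degree may equal the number of nodes. -/
theorem eval_eq_nodal_mul_of_natDegree_le {p : ℝ[X]} (hv : Set.InjOn v s)
    (hp : p.natDegree ≤ s.card) {x : ℝ} (hx : ∀ i ∈ s, x ≠ v i) :
    p.eval x = (nodal s v).eval x *
      (p.coeff s.card + ∑ i ∈ s, nodalWeight s v i * (x - v i)⁻¹ * p.eval (v i)) := by
  have hdeg : (p - C (p.coeff s.card) * nodal s v).degree < s.card := by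
    rw [degree_lt_iff_coeff_zero]
    intro k hk
    rcases hk.eq_or_lt with rfl | hk
    · have h1 : (nodal s v).coeff s.card = 1 := by
        have := (nodal_monic (s := s) (v := v)).coeff_natDegree
        rwa [natDegree_nodal] at this
      rw [coeff_sub, coeff_C_mul, h1, mul_one, sub_self]
    · rw [coeff_sub, coeff_C_mul, coeff_eq_zero_of_natDegree_lt (hp.trans_lt hk),
        coeff_eq_zero_of_natDegree_lt (p := nodal s v) (by rwa [natDegree_nodal]), mul_zero,
        sub_self]
  have hinterp := eq_interpolate_of_eval_eq (fun i => p.eval (v i)) hv hdeg fun i hi => by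
    rw [eval_sub, eval_mul, eval_nodal_at_node hi, mul_zero, sub_zero]
  have heval := congrArg (Polynomial.eval x) hinterp
  rw [eval_interpolate_not_at_node _ hx, eval_sub, eval_mul, eval_C] at heval
  rw [mul_add, ← heval]
  ring

/-- The partial fraction decomposition of the reciprocal of the nodal polynomial. -/
theorem sum_nodalWeight_mul_inv_sub (hv : Set.InjOn v s) (hs : s.Nonempty) {x : ℝ}
    (hx : ∀ i ∈ s, x ≠ v i) :
    ∑ i ∈ s, nodalWeight s v i * (x - v i)⁻¹ = ((nodal s v).eval x)⁻¹ := by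
  refine eq_inv_of_mul_eq_one_right ?_
  have h := eval_interpolate_not_at_node (r := (1 : ι → ℝ)) hx
  rw [interpolate_one hv hs, eval_one] at h
  simpa using h.symm

/-- The nodal weights of an increasing sequence of nodes alternate in sign. -/
theorem neg_one_pow_mul_nodalWeight_pos {m : ℕ} {v : ℕ → ℝ}
    (hv : ∀ i j, 1 ≤ i → i < j → j ≤ m → v i < v j) {i : ℕ} (hi : i ∈ Finset.Icc 1 m) :
    0 < (-1) ^ (m - i) * nodalWeight (Finset.Icc 1 m) v i := by
  obtain ⟨hi1, him⟩ := Finset.mem_Icc.1 hi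
  have hsign : ∏ j ∈ (Finset.Icc 1 m).erase i, (if i < j then (-1 : ℝ) else 1)
      = (-1) ^ (m - i) := by
    have hfilter : ((Finset.Icc 1 m).erase i).filter (fun j => i < j) = Finset.Ioc i m := by
      ext j
      simp only [Finset.mem_filter, Finset.mem_erase, Finset.mem_Icc, Finset.mem_Ioc]
      omega
    rw [Finset.prod_ite, Finset.prod_const, Finset.prod_const_one, mul_one, hfilter, Nat.card_Ioc]
  rw [nodalWeight, ← hsign, ← Finset.prod_mul_distrib]
  refine Finset.prod_pos fun j hj => ?_
  obtain ⟨hji, hj1, hjm⟩ : j ≠ i ∧ 1 ≤ j ∧ j ≤ m := by simpa using hj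
  rcases lt_or_gt_of_ne hji with h | h
  · rw [if_neg h.not_gt, one_mul, inv_pos, sub_pos]
    exact hv j i hj1 h him
  · rw [if_pos h, neg_one_mul, neg_pos, inv_lt_zero, sub_neg]
    exact hv i j hi1 h hjm

/-- A primitive of the reciprocal of the nodal polynomial. -/
noncomputable def nodalPrimitive (s : Finset ι) (v : ι → ℝ) (x : ℝ) : ℝ :=
  ∑ i ∈ s, nodalWeight s v i * Real.log (x - v i)

theorem hasDerivAt_nodalPrimitive (hv : Set.InjOn v s) (hs : s.Nonempty) {x : ℝ}
    (hx : ∀ i ∈ s, x ≠ v i) :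
    HasDerivAt (nodalPrimitive s v) ((nodal s v).eval x)⁻¹ x := by
  rw [← sum_nodalWeight_mul_inv_sub hv hs hx]
  refine HasDerivAt.fun_sum fun i hi => ?_
  have h := (((hasDerivAt_id x).sub_const (v i)).log (sub_ne_zero.2 (hx i hi))).const_mul
    (nodalWeight s v i)
  simpa using h

/-- Between two points not separated by a node, the difference quotient of the primitive has the
sign of the nodal polynomial. -/
theorem exists_nodalPrimitive_sub_eq (hv : Set.InjOn v s) (hs : s.Nonempty) {x y : ℝ}
    (hxy : ∀ i ∈ s, 0 < (x - v i) * (y - v i)) :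
    ∃ r, 0 < r * (nodal s v).eval x ∧
      nodalPrimitive s v x - nodalPrimitive s v y = r * (x - y) := by
  have main : ∀ {x y : ℝ}, x < y → (∀ i ∈ s, 0 < (x - v i) * (y - v i)) →
      ∃ z, (∀ i ∈ s, 0 < (z - v i) * (x - v i)) ∧ (∀ i ∈ s, 0 < (z - v i) * (y - v i)) ∧
        nodalPrimitive s v x - nodalPrimitive s v y = ((nodal s v).eval z)⁻¹ * (x - y) := by
    intro x y hlt h
    have hbetween : ∀ z ∈ Icc x y, ∀ i ∈ s,
        0 < (z - v i) * (x - v i) ∧ 0 < (z - v i) * (y - v i) := by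
      intro z hz i hi
      rcases pos_and_pos_or_neg_and_neg_of_mul_pos (h i hi) with ⟨h1, h2⟩ | ⟨h1, h2⟩
      · have : 0 < z - v i := by linarith [hz.1]
        exact ⟨mul_pos this h1, mul_pos this h2⟩
      · have : z - v i < 0 := by linarith [hz.2]
        exact ⟨mul_pos_of_neg_of_neg this h1, mul_pos_of_neg_of_neg this h2⟩
    have hderiv : ∀ z ∈ Icc x y,
        HasDerivAt (nodalPrimitive s v) ((nodal s v).eval z)⁻¹ z := fun z hz =>
      hasDerivAt_nodalPrimitive hv hs fun i hi =>
        sub_ne_zero.1 (left_ne_zero_of_mul (hbetween z hz i hi).1.ne')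
    obtain ⟨z, hz, hzeq⟩ := exists_hasDerivAt_eq_slope (nodalPrimitive s v)
      (fun z => ((nodal s v).eval z)⁻¹) hlt
      (fun z hz => (hderiv z hz).continuousAt.continuousWithinAt)
      (fun z hz => hderiv z (Ioo_subset_Icc_self hz))
    have hz' := Ioo_subset_Icc_self hz
    refine ⟨z, fun i hi => (hbetween z hz' i hi).1, fun i hi => (hbetween z hz' i hi).2, ?_⟩
    rw [hzeq, div_mul_eq_mul_div, eq_div_iff (sub_pos.2 hlt).ne']
    ring
  have hsign : ∀ {z : ℝ}, (∀ i ∈ s, 0 < (z - v i) * (x - v i)) →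
      0 < ((nodal s v).eval z)⁻¹ * (nodal s v).eval x := by
    intro z hz
    rw [← inv_pos, mul_inv, inv_inv, ← div_eq_mul_inv]
    have hprod : 0 < (nodal s v).eval z * (nodal s v).eval x := by
      rw [eval_nodal, eval_nodal, ← Finset.prod_mul_distrib]
      exact Finset.prod_pos hz
    rcases pos_and_pos_or_neg_and_neg_of_mul_pos hprod with ⟨h1, h2⟩ | ⟨h1, h2⟩
    · exact div_pos h1 h2
    · exact div_pos_of_neg_of_neg h1 h2
  rcases lt_trichotomy x y with hlt | rfl | hlt
  · obtain ⟨z, hzx, -, hz⟩ := main hlt hxy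
    exact ⟨_, hsign hzx, hz⟩
  · exact ⟨_, hsign hxy, by simp⟩
  · obtain ⟨z, -, hzx, hz⟩ := main hlt fun i hi => mul_comm (x - v i) _ ▸ hxy i hi
    exact ⟨_, hsign hzx, by linarith⟩


variable {P : ℝ → ℝ[X]} {σ : ℝ} {y z : ℝ → ℝ}

/-- If `P t (v i)` has constant sign, a periodic solution of `y' = P t y` never meets `v i`. -/
theorem isPeriodicSol_ne_node (hσ : ∀ t ∈ Icc (0 : ℝ) 1, ∀ i ∈ s,
      0 < σ * (nodalWeight s v i * (P t).eval (v i)))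
    (hy : IsPeriodicSol (fun x t => (P t).eval x) y) :
    ∀ t ∈ Icc (0 : ℝ) 1, ∀ i ∈ s, y t ≠ v i := by
  intro t ht i hi hyt
  refine ne_zero_of_endpoints_eq_of_deriv_pos zero_lt_one
    (f := fun t => σ * nodalWeight s v i * (y t - v i))
    (f' := fun t => σ * nodalWeight s v i * (P t).eval (y t))
    (fun t ht => ((hy.1 t ht).sub_const (v i)).const_mul _) (fun t ht h0 => ?_)
    (by simp only [hy.2]) t ht (by simp [hyt])
  have hpos := hσ t ht i hi
  have hne : σ * nodalWeight s v i ≠ 0 :=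
    mul_ne_zero (left_ne_zero_of_mul hpos.ne')
      (left_ne_zero_of_mul (right_ne_zero_of_mul hpos.ne'))
  rw [sub_eq_zero.1 ((mul_eq_zero.1 h0).resolve_left hne), mul_assoc]
  exact hpos

/-- The evolution of the primitive along a solution of `y' = P t y`. -/
theorem hasDerivWithinAt_nodalPrimitive_comp (hv : Set.InjOn v s) (hs : s.Nonempty)
    {p : ℝ[X]} (hp : p.natDegree ≤ s.card) {I : Set ℝ} {t : ℝ}
    (hy : HasDerivWithinAt y (p.eval (y t)) I t) (hne : ∀ i ∈ s, y t ≠ v i) :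
    HasDerivWithinAt (fun t => nodalPrimitive s v (y t))
      (p.coeff s.card + ∑ i ∈ s, nodalWeight s v i * (y t - v i)⁻¹ * p.eval (v i)) I t := by
  have h := (hasDerivAt_nodalPrimitive hv hs hne).comp_hasDerivWithinAt t hy
  rwa [eval_eq_nodal_mul_of_natDegree_le hv hp hne,
    inv_mul_cancel_left₀ (eval_nodal_not_at_node hne)] at h

/-- No two periodic solutions lie on opposite sides of all nodes. -/
theorem not_isPeriodicSol_below_and_above (hv : Set.InjOn v s) (hs : s.Nonempty)
    (hP : ∀ t ∈ Icc (0 : ℝ) 1, (P t).natDegree ≤ s.card)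
    (hσ : ∀ t ∈ Icc (0 : ℝ) 1, ∀ i ∈ s, 0 < σ * (nodalWeight s v i * (P t).eval (v i)))
    (hy : IsPeriodicSol (fun x t => (P t).eval x) y)
    (hz : IsPeriodicSol (fun x t => (P t).eval x) z)
    (hyv : ∀ t ∈ Icc (0 : ℝ) 1, ∀ i ∈ s, y t < v i)
    (hvz : ∀ t ∈ Icc (0 : ℝ) 1, ∀ i ∈ s, v i < z t) : False := by
  have hderiv : ∀ t ∈ Icc (0 : ℝ) 1, HasDerivWithinAt
      (fun t => σ * (nodalPrimitive s v (y t) - nodalPrimitive s v (z t)))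
      (∑ i ∈ s, σ * (nodalWeight s v i * (P t).eval (v i)) * ((y t - v i)⁻¹ - (z t - v i)⁻¹))
      (Icc 0 1) t := by
    intro t ht
    have hd := ((hasDerivWithinAt_nodalPrimitive_comp hv hs (hP t ht) (hy.1 t ht)
      fun i hi => (hyv t ht i hi).ne).sub
      (hasDerivWithinAt_nodalPrimitive_comp hv hs (hP t ht) (hz.1 t ht)
        fun i hi => (hvz t ht i hi).ne')).const_mul σ
    refine hd.congr_deriv ?_
    rw [add_sub_add_left_eq_sub, ← Finset.sum_sub_distrib, Finset.mul_sum]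
    exact Finset.sum_congr rfl fun i _ => by ring
  have hneg : ∀ t ∈ Icc (0 : ℝ) 1, ∑ i ∈ s,
      σ * (nodalWeight s v i * (P t).eval (v i)) * ((y t - v i)⁻¹ - (z t - v i)⁻¹) < 0 := by
    intro t ht
    refine Finset.sum_neg (fun i hi => mul_neg_of_pos_of_neg (hσ t ht i hi) ?_) hs
    have h1 : (y t - v i)⁻¹ < 0 := inv_lt_zero.2 (sub_neg.2 (hyv t ht i hi))
    have h2 : 0 < (z t - v i)⁻¹ := inv_pos.2 (sub_pos.2 (hvz t ht i hi))
    linarith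
  have h0 : (0 : ℝ) ∈ Icc (0 : ℝ) 1 := left_mem_Icc.2 zero_le_one
  exact (hneg 0 h0).ne (hasDerivWithinAt_eq_zero_of_nonpos_of_eq zero_lt_one hderiv
    (fun t ht => (hneg t ht).le) (by simp only [hy.2, hz.2]) h0)

/-- Two periodic solutions not separated by a node have the same initial value. -/
theorem isPeriodicSol_initial_eq_of_same_side (hv : Set.InjOn v s) (hs : s.Nonempty)
    (hP : ∀ t ∈ Icc (0 : ℝ) 1, (P t).natDegree ≤ s.card)
    (hσ : ∀ t ∈ Icc (0 : ℝ) 1, ∀ i ∈ s, 0 < σ * (nodalWeight s v i * (P t).eval (v i)))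
    (hy : IsPeriodicSol (fun x t => (P t).eval x) y)
    (hz : IsPeriodicSol (fun x t => (P t).eval x) z)
    (hyz : ∀ t ∈ Icc (0 : ℝ) 1, ∀ i ∈ s, 0 < (y t - v i) * (z t - v i)) : y 0 = z 0 := by
  have hyne := isPeriodicSol_ne_node hσ hy
  have hzne := isPeriodicSol_ne_node hσ hz
  have h0 : (0 : ℝ) ∈ Icc (0 : ℝ) 1 := left_mem_Icc.2 zero_le_one
  set N : ℝ → ℝ := fun x => (nodal s v).eval x with hN
  set K : ℝ → ℝ := fun t => ∑ i ∈ s, σ * (nodalWeight s v i * (P t).eval (v i)) *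
    ((y t - v i) * (z t - v i))⁻¹ with hK
  have hKpos : ∀ t ∈ Icc (0 : ℝ) 1, 0 < K t := fun t ht =>
    Finset.sum_pos (fun i hi => mul_pos (hσ t ht i hi) (inv_pos.2 (hyz t ht i hi))) hs
  have hNsign : ∀ t ∈ Icc (0 : ℝ) 1, 0 < N (y t) * N (y 0) := fun t ht =>
    ContinuousOn.mul_pos_of_ne_zero_on_Icc (f := fun t => N (y t))
      ((nodal s v).continuous.comp_continuousOn fun t ht => (hy.1 t ht).continuousWithinAt)
      (fun t ht => eval_nodal_not_at_node (hyne t ht)) ht h0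
  choose! r hrpos hr using fun t (ht : t ∈ Icc (0 : ℝ) 1) =>
    exists_nodalPrimitive_sub_eq hv hs (hyz t ht)
  have hrN : ∀ t ∈ Icc (0 : ℝ) 1, 0 < r t * N (y 0) := by
    intro t ht
    have h1 : 0 < (r t * N (y t)) * (N (y t) * N (y 0)) := mul_pos (hrpos t ht) (hNsign t ht)
    have h2 : 0 < N (y t) ^ 2 := by
      have := left_ne_zero_of_mul (hNsign t ht).ne'
      positivity
    refine (mul_pos_iff_of_pos_right h2).1 ?_
    linarith
  have hderiv : ∀ t ∈ Icc (0 : ℝ) 1, HasDerivWithinAt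
      (fun t => σ * N (y 0) * (nodalPrimitive s v (y t) - nodalPrimitive s v (z t)) ^ 2)
      (-(2 * (r t * N (y 0)) * K t * (y t - z t) ^ 2)) (Icc 0 1) t := by
    intro t ht
    have hd := (((hasDerivWithinAt_nodalPrimitive_comp hv hs (hP t ht) (hy.1 t ht)
      (hyne t ht)).sub (hasDerivWithinAt_nodalPrimitive_comp hv hs (hP t ht) (hz.1 t ht)
      (hzne t ht))).pow 2).const_mul (σ * N (y 0))
    refine hd.congr_deriv ?_
    have hsum : σ * (∑ i ∈ s, nodalWeight s v i * (y t - v i)⁻¹ * (P t).eval (v i) -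
        ∑ i ∈ s, nodalWeight s v i * (z t - v i)⁻¹ * (P t).eval (v i)) =
        -((y t - z t) * K t) := by
      rw [hK, ← Finset.sum_sub_distrib, Finset.mul_sum, Finset.mul_sum, ← Finset.sum_neg_distrib]
      refine Finset.sum_congr rfl fun i hi => ?_
      have h1 := sub_ne_zero.2 (hyne t ht i hi)
      have h2 := sub_ne_zero.2 (hzne t ht i hi)
      field_simp
      ring
    rw [add_sub_add_left_eq_sub]
    simp only [Pi.sub_apply, hr t ht]
    push_cast
    linear_combination (2 * N (y 0) * r t * (y t - z t)) * hsum
  have hzero := hasDerivWithinAt_eq_zero_of_nonpos_of_eq zero_lt_one hderiv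
    (fun t ht => neg_nonpos.2 <| mul_nonneg
      (mul_nonneg (mul_nonneg zero_le_two (hrN t ht).le) (hKpos t ht).le) (sq_nonneg _))
    (by simp only [← hy.2, ← hz.2]) h0
  have hcoef : 2 * (r 0 * N (y 0)) * K 0 ≠ 0 :=
    (mul_pos (mul_pos two_pos (hrN 0 h0)) (hKpos 0 h0)).ne'
  exact sub_eq_zero.1 (pow_eq_zero_iff two_ne_zero |>.1
    ((mul_eq_zero.1 (neg_eq_zero.1 hzero)).resolve_left hcoef))

/-- Let `P t` be polynomials of degree at most the number of nodes, such that the numbers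
`nodalWeight s v i * P t (v i)` all have the same sign. Then `y' = P t y` has at most as many
periodic solutions as there are nodes. -/
theorem exists_finset_card_le_of_isPeriodicSol (hv : Set.InjOn v s) (hs : s.Nonempty)
    (hP : ∀ t ∈ Icc (0 : ℝ) 1, (P t).natDegree ≤ s.card)
    (hσ : ∀ t ∈ Icc (0 : ℝ) 1, ∀ i ∈ s, 0 < σ * (nodalWeight s v i * (P t).eval (v i))) :
    ∃ F : Finset ℝ, F.card ≤ s.card ∧
      {y₀ : ℝ | ∃ y, IsPeriodicSol (fun x t => (P t).eval x) y ∧ y 0 = y₀} ⊆ (F : Set ℝ) := by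
  set A : Set ℝ := {y₀ : ℝ | ∃ y, IsPeriodicSol (fun x t => (P t).eval x) y ∧ y 0 = y₀}
  set below : ℝ → Finset ι := fun x => s.filter fun i => v i < x with hbelow
  have h0 : (0 : ℝ) ∈ Icc (0 : ℝ) 1 := left_mem_Icc.2 zero_le_one
  have hcard : 0 < s.card := hs.card_pos
  have hside : ∀ y, IsPeriodicSol (fun x t => (P t).eval x) y →
      ∀ t ∈ Icc (0 : ℝ) 1, ∀ i ∈ s, 0 < (y t - v i) * (y 0 - v i) := fun y hy t ht i hi =>
    ContinuousOn.mul_pos_of_ne_zero_on_Icc (f := fun t => y t - v i)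
      (fun t ht => ((hy.1 t ht).sub_const (v i)).continuousWithinAt)
      (fun t ht => sub_ne_zero.2 (isPeriodicSol_ne_node hσ hy t ht i hi)) ht h0
  have hinj : Set.InjOn (fun x => (below x).card % s.card) A := by
    suffices h : ∀ y z : ℝ → ℝ, IsPeriodicSol (fun x t => (P t).eval x) y →
        IsPeriodicSol (fun x t => (P t).eval x) z → y 0 ≤ z 0 →
        (below (y 0)).card % s.card = (below (z 0)).card % s.card → y 0 = z 0 by
      rintro _ ⟨y, hy, rfl⟩ _ ⟨z, hz, rfl⟩ heq
      rcases le_total (y 0) (z 0) with hle | hle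
      · exact h y z hy hz hle heq
      · exact (h z y hz hy hle heq.symm).symm
    intro y z hy hz hle hmod
    have hsub : below (y 0) ⊆ below (z 0) :=
      Finset.monotone_filter_right s fun i _ hi => lt_of_lt_of_le hi hle
    have hyz := Finset.card_le_card hsub
    have hzs : (below (z 0)).card ≤ s.card := Finset.card_filter_le _ _
    have hcases : (below (y 0)).card = (below (z 0)).card ∨
        (below (y 0)).card = 0 ∧ (below (z 0)).card = s.card := by
      rcases hzs.lt_or_eq with hlt | heq
      · rw [Nat.mod_eq_of_lt hlt, Nat.mod_eq_of_lt (hyz.trans_lt hlt)] at hmod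
        exact Or.inl hmod
      · rcases (hyz.trans hzs).lt_or_eq with hlt | heq'
        · rw [heq, Nat.mod_self, Nat.mod_eq_of_lt hlt] at hmod
          exact Or.inr ⟨hmod, heq⟩
        · exact Or.inl (heq'.trans heq.symm)
    rcases hcases with heq | ⟨hlow, hhigh⟩
    · refine isPeriodicSol_initial_eq_of_same_side hv hs hP hσ hy hz fun t ht i hi => ?_
      have hiff : v i < y 0 ↔ v i < z 0 := by
        have := Finset.ext_iff.1 (Finset.eq_of_subset_of_card_le hsub heq.ge) i
        simpa [hbelow, hi] using this
      have h1 := hside y hy t ht i hi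
      have h2 := hside z hz t ht i hi
      by_cases hlt : v i < y 0
      · exact mul_pos (pos_of_mul_pos_left h1 (sub_pos.2 hlt).le)
          (pos_of_mul_pos_left h2 (sub_pos.2 (hiff.1 hlt)).le)
      · exact mul_pos_of_neg_of_neg
          (neg_of_mul_pos_left h1 (sub_nonpos.2 (not_lt.1 hlt)))
          (neg_of_mul_pos_left h2 (sub_nonpos.2 (not_lt.1 (mt hiff.2 hlt))))
    · refine (not_isPeriodicSol_below_and_above hv hs hP hσ hy hz (fun t ht i hi => ?_)
        fun t ht i hi => ?_).elim
      · have hlt : ¬ v i < y 0 := fun h =>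
          Finset.notMem_empty i (Finset.card_eq_zero.1 hlow ▸ Finset.mem_filter.2 ⟨hi, h⟩)
        exact sub_neg.1 (neg_of_mul_pos_left (hside y hy t ht i hi)
          (sub_nonpos.2 (not_lt.1 hlt)))
      · have hlt : v i < z 0 := by
          have hmem : i ∈ below (z 0) :=
            (Finset.eq_of_subset_of_card_le (Finset.filter_subset _ s) hhigh.ge).ge hi
          exact (Finset.mem_filter.1 hmem).2
        exact sub_pos.1 (pos_of_mul_pos_left (hside z hz t ht i hi) (sub_pos.2 hlt).le)
  have hmaps : Set.MapsTo (fun x => (below x).card % s.card) A (Finset.range s.card) :=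
    fun x _ => Finset.mem_coe.2 (Finset.mem_range.2 (Nat.mod_lt _ hcard))
  have hfin : A.Finite := Set.Finite.of_injOn hmaps hinj (Finset.finite_toSet _)
  refine ⟨hfin.toFinset, ?_, hfin.coe_toFinset.ge⟩
  have := Finset.card_le_card_of_injOn (s := hfin.toFinset) (t := Finset.range s.card)
    (fun x => (below x).card % s.card) (by simpa using hmaps) (by simpa using hinj)
  simpa using this

end Lagrange

open Polynomial in
/-- The right-hand side of an Abel equation in the coordinate `y`, where `x = a y + b`, at a fixed
time. -/
noncomputable def abelPullback (m : ℕ) (c : ℕ → ℝ) (a b a' b' : ℝ) : ℝ[X] :=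
  C a⁻¹ * (∑ i ∈ Finset.range (m + 1), C (c i) * (C a * X + C b) ^ i - C a' * X - C b')

open Polynomial in
theorem eval_abelPullback (m : ℕ) (c : ℕ → ℝ) (a b a' b' y : ℝ) :
    (abelPullback m c a b a' b').eval y =
      a⁻¹ * (∑ i ∈ Finset.range (m + 1), c i * (y * a + b) ^ i - y * a' - b') := by
  simp only [abelPullback, eval_mul, eval_sub, eval_add, eval_pow, eval_C, eval_X, eval_finsetSum,
    mul_comm a y, mul_comm a' y]

open Polynomial in
theorem natDegree_abelPullback_le {m : ℕ} (hm : 1 ≤ m) (c : ℕ → ℝ) (a b a' b' : ℝ) :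
    (abelPullback m c a b a' b').natDegree ≤ m := by
  refine (natDegree_C_mul_le _ _).trans ?_
  refine (natDegree_sub_le _ _).trans
    (max_le ((natDegree_sub_le _ _).trans (max_le ?_ ?_)) (by simp))
  · refine natDegree_sum_le_of_forall_le _ _ fun i hi => (natDegree_C_mul_le _ _).trans ?_
    calc ((C a * X + C b) ^ i).natDegree ≤ i * 1 :=
          natDegree_pow_le_of_le i natDegree_linear_le
      _ ≤ m := by simpa [Nat.lt_succ_iff] using hi
  · exact (natDegree_C_mul_le _ _).trans (natDegree_X_le.trans hm)

/-- The change of variable `x = a y + b` carries periodic solutions to periodic solutions. -/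
theorem IsPeriodicSol.sub_div {S : ℝ → ℝ → ℝ} {P : ℝ → Polynomial ℝ} {a b a' b' x : ℝ → ℝ}
    (hx : IsPeriodicSol S x)
    (ha' : ∀ t ∈ Icc (0 : ℝ) 1, HasDerivWithinAt a (a' t) (Icc (0 : ℝ) 1) t)
    (hb' : ∀ t ∈ Icc (0 : ℝ) 1, HasDerivWithinAt b (b' t) (Icc (0 : ℝ) 1) t)
    (haper : a 0 = a 1) (hbper : b 0 = b 1) (ha : ∀ t ∈ Icc (0 : ℝ) 1, a t ≠ 0)
    (hP : ∀ t y, (P t).eval y = (a t)⁻¹ * (S (y * a t + b t) t - y * a' t - b' t)) :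
    IsPeriodicSol (fun y t => (P t).eval y) (fun t => (x t - b t) / a t) := by
  refine ⟨fun t ht => ?_, by simp only [hx.2, haper, hbper]⟩
  refine (((hx.1 t ht).sub (hb' t ht)).div (ha' t ht) (ha t ht)).congr_deriv ?_
  have hat := ha t ht
  simp only [hP, div_mul_cancel₀ _ hat, sub_add_cancel, Pi.sub_apply]
  field_simp
  ring

/-- A sequence of functions with alternating orientations, the first of which has constant sign. -/
theorem exists_sign_of_alternating {T : Set ℝ} (hT : T.Nonempty) {m : ℕ} {d : ℕ → ℝ → ℝ}
    (hfirst : ∀ t ∈ T, ∀ u ∈ T, 0 < d 1 t * d 1 u)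
    (hopp : ∀ i, 1 ≤ i → i < m → ∀ t ∈ T, ∀ u ∈ T, d i t * d (i + 1) u < 0) :
    ∃ σ : ℝ, ∀ i, 1 ≤ i → i ≤ m → ∀ t ∈ T, 0 < σ * (-1) ^ i * d i t := by
  obtain ⟨t₀, ht₀⟩ := hT
  refine ⟨-d 1 t₀, fun i hi => ?_⟩
  induction i, hi using Nat.le_induction with
  | base =>
    intro _ t ht
    linarith [hfirst t₀ ht₀ t ht]
  | succ i hi ih =>
    intro him t ht
    have h1 := ih (by omega) t ht
    have h2 := hopp i hi (by omega) t ht t ht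
    have h3 : 0 < d i t ^ 2 := by
      have := left_ne_zero_of_mul h2.ne
      positivity
    refine (mul_pos_iff_of_pos_right h3).1 ?_
    have h4 := mul_pos_of_neg_of_neg (mul_neg_of_pos_of_neg h1 h2) (neg_one_lt_zero (R := ℝ))
    rw [pow_succ]
    linarith


/-- Corollary 1.5: if the vector field of the equation is transverse to the curves
`γ_{λ₁}, …, γ_{λ_m}` with alternating orientations, then the generalized Abel equation
has at most `m` isolated periodic solutions.  Transversality and orientations are
expressed via the determinant `D lam t = S (lam * a t + b t) t - lam * a' t - b' t`. -/
theorem abel_transverse_at_most_m (m : ℕ) (hm : 1 ≤ m) (aco : ℕ → ℝ → ℝ)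
    (haco : ∀ i ≤ m, ContDiffOn ℝ (⊤ : ℕ∞) (aco i) (Set.Icc (0:ℝ) 1))
    (S : ℝ → ℝ → ℝ)
    (hS : ∀ x t, S x t = ∑ i ∈ Finset.range (m + 1), aco i t * x ^ i)
    (a b a' b' : ℝ → ℝ)
    (haS : ContDiffOn ℝ (⊤ : ℕ∞) a (Set.Icc (0:ℝ) 1))
    (hbS : ContDiffOn ℝ (⊤ : ℕ∞) b (Set.Icc (0:ℝ) 1))
    (ha' : ∀ t ∈ Set.Icc (0:ℝ) 1, HasDerivWithinAt a (a' t) (Set.Icc (0:ℝ) 1) t)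
    (hb' : ∀ t ∈ Set.Icc (0:ℝ) 1, HasDerivWithinAt b (b' t) (Set.Icc (0:ℝ) 1) t)
    (haper : a 0 = a 1) (hbper : b 0 = b 1)
    (hapos : ∀ t ∈ Set.Icc (0:ℝ) 1, 0 < a t)
    (D : ℝ → ℝ → ℝ)
    (hD : ∀ lam t, D lam t = S (lam * a t + b t) t - lam * a' t - b' t)
    (lam : ℕ → ℝ)
    (hlt : ∀ i j, 1 ≤ i → i < j → j ≤ m → lam i < lam j)
    (htrans : ∀ i, 1 ≤ i → i ≤ m → ∀ t ∈ Set.Icc (0:ℝ) 1, D (lam i) t ≠ 0)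
    (hopp : ∀ i, 1 ≤ i → i < m → ∀ t ∈ Set.Icc (0:ℝ) 1, ∀ s ∈ Set.Icc (0:ℝ) 1,
      D (lam i) t * D (lam (i + 1)) s < 0) :
    ∃ F : Finset ℝ, F.card ≤ m ∧
      {x0 : ℝ | ∃ x : ℝ → ℝ, IsIsolatedPeriodicSol S x ∧ x 0 = x0} ⊆ (F : Set ℝ) := by
  have h0 : (0 : ℝ) ∈ Icc (0 : ℝ) 1 := left_mem_Icc.2 zero_le_one
  have hderivCont : ∀ {f f' : ℝ → ℝ}, ContDiffOn ℝ (⊤ : ℕ∞) f (Icc (0 : ℝ) 1) →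
      (∀ t ∈ Icc (0 : ℝ) 1, HasDerivWithinAt f (f' t) (Icc (0 : ℝ) 1) t) →
      ContinuousOn f' (Icc (0 : ℝ) 1) := fun hf hf' =>
    (hf.continuousOn_derivWithin (uniqueDiffOn_Icc_zero_one) (by simp)).congr fun t ht =>
      ((hf' t ht).derivWithin (uniqueDiffOn_Icc_zero_one t ht)).symm
  have hDcont : ContinuousOn (D (lam 1)) (Icc (0 : ℝ) 1) := by
    have hSsum : ContinuousOn (fun t => ∑ i ∈ Finset.range (m + 1),
        aco i t * (lam 1 * a t + b t) ^ i) (Icc (0 : ℝ) 1) :=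
      continuousOn_finsetSum _ fun i hi =>
        (haco i (Nat.lt_succ_iff.1 (Finset.mem_range.1 hi))).continuousOn.mul
          (((haS.continuousOn.const_mul _).add hbS.continuousOn).pow i)
    refine ((hSsum.sub ((hderivCont haS ha').const_mul (lam 1))).sub
      (hderivCont hbS hb')).congr fun t _ => ?_
    simp only [hD, hS, Pi.sub_apply]
  obtain ⟨σ, hσ⟩ := exists_sign_of_alternating (d := fun i => D (lam i)) ⟨0, h0⟩
    (fun t ht u hu => hDcont.mul_pos_of_ne_zero_on_Icc (htrans 1 le_rfl hm) ht hu) hopp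
  have hinj : Set.InjOn lam (Finset.Icc 1 m) := by
    have hmono : StrictMonoOn lam (Finset.Icc 1 m) := fun i hi j hj hij =>
      hlt i j (Finset.mem_Icc.1 hi).1 hij (Finset.mem_Icc.1 hj).2
    exact hmono.injOn
  have hP : ∀ t y, (abelPullback m (fun i => aco i t) (a t) (b t) (a' t) (b' t)).eval y =
      (a t)⁻¹ * (S (y * a t + b t) t - y * a' t - b' t) := fun t y => by
    rw [eval_abelPullback, hS]
  obtain ⟨F, hFcard, hF⟩ := Lagrange.exists_finset_card_le_of_isPeriodicSol
    (P := fun t => abelPullback m (fun i => aco i t) (a t) (b t) (a' t) (b' t))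
    (σ := σ * (-1) ^ m) hinj ⟨1, Finset.mem_Icc.2 ⟨le_rfl, hm⟩⟩
    (fun t _ => by simpa using natDegree_abelPullback_le hm _ _ _ _ _)
    (fun t ht i hi => by
      have hi' := Finset.mem_Icc.1 hi
      have h1 := mul_pos (mul_pos (Lagrange.neg_one_pow_mul_nodalWeight_pos hlt hi)
        (hσ i hi'.1 hi'.2 t ht)) (inv_pos.2 (hapos t ht))
      have hpow : (-1 : ℝ) ^ m = (-1) ^ (m - i) * (-1) ^ i := by
        rw [← pow_add, Nat.sub_add_cancel hi'.2]
      rw [hP, ← hD, hpow]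
      linarith)
  refine ⟨F.image fun y₀ => y₀ * a 0 + b 0, ?_, ?_⟩
  · exact Finset.card_image_le.trans (by simpa using hFcard)
  · rintro _ ⟨x, hx, rfl⟩
    have hy := hx.1.sub_div ha' hb' haper hbper (fun t ht => (hapos t ht).ne') hP
    refine Finset.mem_coe.2 (Finset.mem_image.2 ⟨_, hF ⟨_, hy, rfl⟩, ?_⟩)
    rw [div_mul_cancel₀ _ (hapos 0 h0).ne', sub_add_cancel]
end
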